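/- The critical density of activated random walk satisfies ρ_c(ℤ^d, P, λ) ≤ limsup_{V ↗ ℤ^d} sup_{active ξ ∈ ℕ^{ℤ^d}} P(0 ∈ Stab_V ξ), where the limsup over finite sets V ⊂ ℤ^d directed by inclusion is defined as lim_{finite V ↗ ℤ^d} sup_{finite U ⊇ V} sup_{active ξ ∈ ℕ^{ℤ^d}} P(0 ∈ Stab_U ξ). -/

import Mathlib

/-!
Common framework for the activated random walk (ARW) model on `ℤ^d`,
via the site-wise (Diaconis–Fulton) representation.
-/

open MeasureTheory ENNReal Filter

namespace ARW

noncomputable section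
open scoped Classical

/-- A site of the lattice `ℤ^d`. -/
abbrev Site (d : ℕ) := Fin d → ℤ

/-- An instruction: `none` is a sleep instruction, `some z` is a jump instruction
with displacement `z`. -/
abbrev Instr (d : ℕ) := Option (Site d)

instance (d : ℕ) : MeasurableSpace (Instr d) := ⊤

/-- The array of instruction stacks: `I (x, k)` is the `k`-th instruction at site `x`. -/
abbrev Stacks (d : ℕ) := Site d × ℕ → Instr d

/-- The state of a site: `active n` means `n` active particles (and no sleeping one),
`sleeping` means a single sleeping particle. -/
inductive SiteState : Type
  | active : ℕ → SiteState
  | sleeping : SiteState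
  deriving DecidableEq

/-- A particle configuration. -/
abbrev Config (d : ℕ) := Site d → SiteState

/-- Number of active particles at a site state. -/
def numActive : SiteState → ℕ
  | .active n => n
  | .sleeping => 0

/-- Adding one (active) particle to a site: a sleeping particle is reactivated. -/
def addParticle : SiteState → SiteState
  | .active n => .active (n + 1)
  | .sleeping => .active 2

/-- A state of the system: a configuration together with an odometer
(number of instructions already used at each site). -/
abbrev State (d : ℕ) := Config d × (Site d → ℕ)

/-- Initial state on `V` obtained from an all-active particle count `η` (particles
outside `V` are discarded), with odometer `0`. -/
def initState (d : ℕ) (V : Finset (Site d)) (η : Site d → ℕ) : State d :=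
  (fun x => .active (if x ∈ V then η x else 0), fun _ => 0)

/-- Toppling the site `x` (inside `V`, particles jumping out of `V` are killed):
the next unused instruction at `x` is executed and the odometer at `x` increases by one.
A sleep instruction puts the particle at `x` to sleep if it is alone (otherwise it has
no effect), and a jump instruction moves one particle from `x` to `x + z`
(reactivating a sleeping particle there), killing it if `x + z ∉ V`. -/
def topple {d : ℕ} (V : Finset (Site d)) (I : Stacks d) (x : Site d) (s : State d) :
    State d :=
  let σ := s.1
  let m := s.2
  let σ' : Config d :=
    match I (x, m x) with
    | none => if numActive (σ x) = 1 then Function.update σ x .sleeping else σ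
    | some z =>
        let σ₁ := Function.update σ x (SiteState.active (numActive (σ x) - 1))
        if x + z ∈ V then Function.update σ₁ (x + z) (addParticle (σ₁ (x + z))) else σ₁
  (σ', Function.update m x (m x + 1))

/-- Running a sequence of topplings. -/
def run {d : ℕ} (V : Finset (Site d)) (I : Stacks d) : State d → List (Site d) → State d
  | s, [] => s
  | s, x :: l => run V I (topple V I x s) l

/-- Legality of a toppling sequence: every toppled site lies in `V` and holds at least one
active particle when toppled. -/
def Legal {d : ℕ} (V : Finset (Site d)) (I : Stacks d) : State d → List (Site d) → Prop
  | _, [] => True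
  | s, x :: l => x ∈ V ∧ 1 ≤ numActive (s.1 x) ∧ Legal V I (topple V I x s) l

/-- A configuration is stable in `V` if no site of `V` holds an active particle. -/
def Stable {d : ℕ} (V : Finset (Site d)) (σ : Config d) : Prop :=
  ∀ x ∈ V, numActive (σ x) = 0

/-- The stabilization of `η` in `V` terminates. -/
def StabCompletes {d : ℕ} (V : Finset (Site d)) (I : Stacks d) (η : Site d → ℕ) : Prop :=
  ∃ l, Legal V I (initState d V η) l ∧ Stable V (run V I (initState d V η) l).1

/-- The stable configuration `Stab_V η` (well defined, independently of the chosen legal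
toppling sequence, by the abelian property), when stabilization terminates. -/
def stabConfig {d : ℕ} (V : Finset (Site d)) (I : Stacks d) (η : Site d → ℕ) : Config d :=
  if h : StabCompletes V I η then (run V I (initState d V η) h.choose).1
  else fun _ => .active 0

/-- The event `0 ∈ Stab_V η`: stabilization of `η` in `V` ends with a sleeping particle
at the origin. -/
def SleepAt0 {d : ℕ} (V : Finset (Site d)) (I : Stacks d) (η : Site d → ℕ) : Prop :=
  StabCompletes V I η ∧ stabConfig V I η 0 = .sleeping

/-- The event `0 ∉ Stab_V η`: stabilization of `η` in `V` ends with the origin empty. -/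
def EmptyAt0 {d : ℕ} (V : Finset (Site d)) (I : Stacks d) (η : Site d → ℕ) : Prop :=
  StabCompletes V I η ∧ stabConfig V I η 0 ≠ .sleeping

/-- The limiting odometer of `η` at the origin: the supremum, over finite volumes `V` and
legal toppling sequences in `V`, of the number of topplings performed at the origin. -/
def odom0 {d : ℕ} (I : Stacks d) (η : Site d → ℕ) : ℕ∞ :=
  ⨆ (V : Finset (Site d)) (l : List (Site d)) (_ : Legal V I (initState d V η) l),
    (l.count 0 : ℕ∞)

/-! ### The random instructions -/

/-- The normalized sleep rate `λ_s = λ/(1+λ)`. -/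
def lamS (lam : ℝ) : ℝ := lam / (1 + lam)

/-- The normalized jump rate `λ_J = 1/(1+λ)`. -/
def lamJ (lam : ℝ) : ℝ := 1 / (1 + lam)

/-- The distribution of a single instruction: sleep with probability `λ_s`, jump by `z`
with probability `λ_J · step z`. -/
def instrWeight {d : ℕ} (step : Site d → ℝ) (lam : ℝ) : Instr d → ℝ≥0∞
  | none => ENNReal.ofReal (lamS lam)
  | some z => ENNReal.ofReal (lamJ lam) * ENNReal.ofReal (step z)

/-- `μ` is the law of the i.i.d. instruction stacks: a probability measure whose
finite-dimensional cylinder probabilities are the products of the `instrWeight`s. -/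
def IsStackLaw (d : ℕ) (step : Site d → ℝ) (lam : ℝ) (μ : Measure (Stacks d)) : Prop :=
  IsProbabilityMeasure μ ∧
    ∀ (F : Finset (Site d × ℕ)) (g : Site d × ℕ → Instr d),
      μ {I | ∀ i ∈ F, I i = g i} = ∏ i ∈ F, instrWeight step lam (g i)

/-- The law of the i.i.d. instruction stacks (uniquely determined by its cylinder
probabilities; it exists whenever `step` is a probability distribution and `λ > 0`). -/
def stackLaw (d : ℕ) (step : Site d → ℝ) (lam : ℝ) : Measure (Stacks d) :=
  if h : ∃ μ, IsStackLaw d step lam μ then h.choose else 0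

/-! ### Fixation and the critical density -/

/-- Translation of a particle count by `z`. -/
def shift {d : ℕ} (z : Site d) (η : Site d → ℕ) : Site d → ℕ := fun x => η (x + z)

/-- A translation-ergodic distribution of particles: invariant under all translations,
and every translation-invariant event is trivial. -/
def IsTransErgodic {d : ℕ} (ν : Measure (Site d → ℕ)) : Prop :=
  (∀ z, Measure.map (shift z) ν = ν) ∧
    ∀ s : Set (Site d → ℕ), MeasurableSet s → (∀ z, shift z ⁻¹' s = s) → ν s = 0 ∨ ν s = 1

/-- Almost sure fixation of the initial distribution `ν`: for `ν`-almost every initial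
configuration and almost every instructions, the limiting odometer at the origin is
finite (equivalently, by Amir–Gurel-Gurevich, every particle eventually sleeps forever). -/
def Fixates (d : ℕ) (step : Site d → ℝ) (lam : ℝ) (ν : Measure (Site d → ℕ)) : Prop :=
  ∀ᵐ η ∂ν, ∀ᵐ I ∂(stackLaw d step lam), odom0 I η ≠ ⊤

/-- The critical density `ρ_c(ℤ^d, P, λ)`: the supremum of the densities `ρ` such that
every translation-ergodic probability distribution of active particles with mean `ρ`
particles per site fixates almost surely. -/
def critDensity (d : ℕ) (step : Site d → ℝ) (lam : ℝ) : ℝ :=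
  sSup {ρ : ℝ | 0 ≤ ρ ∧
    ∀ ν : Measure (Site d → ℕ), IsProbabilityMeasure ν → IsTransErgodic ν →
      (∫⁻ η, (η 0 : ℝ≥0∞) ∂ν) = ENNReal.ofReal ρ → Fixates d step lam ν}

/-! ### Random walk quantities -/

/-- Simple symmetric nearest-neighbour step distribution on `ℤ^d`. -/
def ssrwStep (d : ℕ) : Site d → ℝ :=
  fun z => if (∑ i, (z i).natAbs) = 1 then (1 : ℝ) / (2 * d) else 0

/-- `psum w k` : position after the first `k` steps with increments `w`. -/
def psum {d n : ℕ} (w : Fin n → Site d) (k : ℕ) : Site d :=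
  ∑ i ∈ Finset.univ.filter (fun i : Fin n => (i : ℕ) < k), w i

/-- Probability of a given sequence of increments. -/
def pathProb {d n : ℕ} (step : Site d → ℝ) (w : Fin n → Site d) : ℝ := ∏ i, step (w i)

/-- `P(S_n = 0)` for the discrete-time walk started at `0`. -/
def probAt0 {d : ℕ} (step : Site d → ℝ) (n : ℕ) : ℝ :=
  ∑' w : Fin n → Site d, if psum w n = 0 then pathProb step w else 0

/-- The Green's function `G = Σ_{n ≥ 0} P(S_n = 0)` of the walk, valued in `[0, ∞]`.
The walk is transient iff `greenE step < ∞`. -/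
def greenE {d : ℕ} (step : Site d → ℝ) : ℝ≥0∞ :=
  ∑' n : ℕ, ENNReal.ofReal (probAt0 step n)

/-- Probability that the walk returns to `0` for the first time at time `n`, having
stayed inside `A` at all intermediate times. -/
def returnIn {d : ℕ} (step : Site d → ℝ) (A : Set (Site d)) (n : ℕ) : ℝ :=
  ∑' w : Fin n → Site d,
    if (∀ k, 0 < k → k < n → psum w k ≠ 0 ∧ psum w k ∈ A) ∧ psum w n = 0
    then pathProb step w else 0

/-- `P(τ = n)` where `τ` is the first return time to the origin. -/
def firstReturn {d : ℕ} (step : Site d → ℝ) (n : ℕ) : ℝ := returnIn step Set.univ n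

/-- The probability that the walk started at `0` exits `A` strictly before returning
to `0`. -/
def escProb {d : ℕ} (step : Site d → ℝ) (A : Set (Site d)) : ℝ :=
  ∑' n : ℕ, ∑' w : Fin (n + 1) → Site d,
    if (∀ k, 0 < k → k ≤ n → psum w k ≠ 0 ∧ psum w k ∈ A) ∧ psum w (n + 1) ∉ A
    then pathProb step w else 0

/-- `q(ℤ^d, P, λ)`: the probability that a single particle started at the origin falls
asleep at the origin, i.e. that the walk is at `0` after `N` steps where
`P(N = n) = λ_s λ_J^n`. -/
def qProb {d : ℕ} (step : Site d → ℝ) (lam : ℝ) : ℝ :=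
  ∑' n : ℕ, lamS lam * lamJ lam ^ n * probAt0 step n

/-- The ball `B_r = {x : ‖x‖₁ ≤ r}`. -/
def ball (d : ℕ) (r : ℝ) : Set (Site d) := {x | ((∑ i, (x i).natAbs : ℕ) : ℝ) ≤ r}

/-- `η` fills `A`: at least one particle at each site of `A`. -/
def Fills {d : ℕ} (η : Site d → ℕ) (A : Set (Site d)) : Prop := ∀ x ∈ A, 1 ≤ η x

/-! ### Weak stabilization, strong stabilization and the number of chances -/

/-- Legality of a weak toppling sequence (with respect to the origin): off the origin as
usual, while the origin may only be toppled if it holds at least two active particles. -/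
def WLegal {d : ℕ} (V : Finset (Site d)) (I : Stacks d) : State d → List (Site d) → Prop
  | _, [] => True
  | s, x :: l => x ∈ V ∧ (if x = 0 then 2 else 1) ≤ numActive (s.1 x) ∧
      WLegal V I (topple V I x s) l

/-- Weak stability in `V` with respect to the origin. -/
def WStable {d : ℕ} (V : Finset (Site d)) (σ : Config d) : Prop :=
  numActive (σ 0) ≤ 1 ∧ ∀ x ∈ V, x ≠ 0 → numActive (σ x) = 0

/-- The weak stabilization of a state (well defined by the abelian property whenever it
terminates). -/
def weakStab {d : ℕ} (V : Finset (Site d)) (I : Stacks d) (s : State d) : State d :=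
  if h : ∃ l, WLegal V I s l ∧ WStable V (run V I s l).1 then run V I s h.choose else s

/-- The jump-out step: the particle at the origin is acceptably toppled (consuming
instructions at the origin, ignoring the sleep instructions) until it jumps out. -/
def jumpOut {d : ℕ} (V : Finset (Site d)) (I : Stacks d) (s : State d) : State d :=
  if h : ∃ k, (I (0, s.2 0 + k)).isSome then
    let k := Nat.find h
    let z := (I (0, s.2 0 + k)).get (Nat.find_spec h)
    let σ₁ := Function.update s.1 0 (SiteState.active (numActive (s.1 0) - 1))
    let σ' := if (0 : Site d) + z ∈ V then
        Function.update σ₁ ((0 : Site d) + z) (addParticle (σ₁ ((0 : Site d) + z)))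
      else σ₁
    (σ', Function.update s.2 0 (s.2 0 + k + 1))
  else s

/-- The states of the strong stabilization of `η` on `V` with respect to the origin via
successive weak stabilizations: `procState j` is the state after the `(j+1)`-st weak
stabilization; as long as the origin holds an active particle, it is jumped out and the
configuration is weakly stabilized again. -/
def procState {d : ℕ} (V : Finset (Site d)) (I : Stacks d) (η : Site d → ℕ) :
    ℕ → State d
  | 0 => weakStab V I (initState d V η)
  | j + 1 =>
      let s := procState V I η j
      if 1 ≤ numActive (s.1 0) then weakStab V I (jumpOut V I s) else s

/-- The number of chances `Ch(η, V)`: the number of completed iterations of the strong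
stabilization procedure, i.e. the first `j` such that the origin is empty after the
`(j+1)`-st weak stabilization. -/
def chances {d : ℕ} (V : Finset (Site d)) (I : Stacks d) (η : Site d → ℕ) : ℕ∞ :=
  if h : ∃ j, numActive ((procState V I η j).1 0) = 0 then (Nat.find h : ℕ∞) else ⊤

/-- The `j`-th weakly stable configuration `η^W_j` (for `1 ≤ j`). -/
def weakConfig {d : ℕ} (V : Finset (Site d)) (I : Stacks d) (η : Site d → ℕ) (j : ℕ) :
    Config d :=
  (procState V I η (j - 1)).1

/-- The `j`-th sleep trial `b_j` (for `1 ≤ j`): whether the first instruction used in the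
`j`-th jump-out step is a sleep instruction. -/
def sleepTrial {d : ℕ} (V : Finset (Site d)) (I : Stacks d) (η : Site d → ℕ) (j : ℕ) :
    Prop :=
  I (0, (procState V I η (j - 1)).2 0) = none

/-- `a^n` for `n ∈ ℕ∞`, with `a^∞ = 0` (appropriate for `a < 1`). -/
def enpow (a : ℝ≥0∞) : ℕ∞ → ℝ≥0∞
  | ⊤ => 0
  | (n : ℕ) => a ^ n

end
end ARW

open MeasureTheory ENNReal Filter

namespace ARW

/-! ### Abelian property -/

/-- Toppling with a prescribed instruction, on configurations. -/
noncomputable def topInstr {d : ℕ} (V : Finset (Site d)) (o : Instr d) (x : Site d)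
    (s : State d) : State d :=
  (match o with
    | none => if numActive (s.1 x) = 1 then Function.update s.1 x .sleeping else s.1
    | some z =>
        if x + z ∈ V then
          Function.update (Function.update s.1 x (SiteState.active (numActive (s.1 x) - 1))) (x + z)
            (addParticle ((Function.update s.1 x
              (SiteState.active (numActive (s.1 x) - 1))) (x + z)))
        else Function.update s.1 x (SiteState.active (numActive (s.1 x) - 1)),
    Function.update s.2 x (s.2 x + 1))

lemma topple_eq {d : ℕ} (V : Finset (Site d)) (I : Stacks d) (x : Site d) (s : State d) :
    topple V I x s = topInstr V (I (x, s.2 x)) x s := by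
  unfold topple topInstr
  cases h : I (x, s.2 x) <;> simp only [h]

lemma exists_active {a : SiteState} (h : 1 ≤ numActive a) : ∃ n, a = .active (n + 1) := by
  cases a with
  | active n =>
    cases n with
    | zero => simp [numActive] at h
    | succ n => exact ⟨n, rfl⟩
  | sleeping => simp [numActive] at h

lemma topple_odom {d : ℕ} (V : Finset (Site d)) (I : Stacks d) (x : Site d) (s : State d) :
    (topple V I x s).2 = Function.update s.2 x (s.2 x + 1) := rfl

lemma numActive_add (a : SiteState) : numActive a ≤ numActive (addParticle a) := by
  cases a <;> simp [numActive, addParticle]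

/-- An unstable site stays unstable when another site is toppled. -/
lemma numActive_topple {d : ℕ} (V : Finset (Site d)) (I : Stacks d) {x y : Site d} (hxy : y ≠ x)
    (s : State d) : numActive (s.1 x) ≤ numActive ((topple V I y s).1 x) := by
  rw [topple_eq]
  unfold topInstr
  rcases I (y, s.2 y) with _ | z
  · by_cases h : numActive (s.1 y) = 1 <;> simp [h, Function.update_of_ne hxy.symm]
  · by_cases h : y + z ∈ V
    · by_cases hx : x = y + z
      · subst hx
        simp [h, Function.update_of_ne hxy.symm, numActive_add]
      · simp [h, Function.update_of_ne hxy.symm, Function.update_of_ne hx]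
    · simp [h, Function.update_of_ne hxy.symm]

lemma topInstr_comm {d : ℕ} (V : Finset (Site d)) {x y : Site d} (hxy : x ≠ y)
    (o o' : Instr d) (s : State d) (hx : 1 ≤ numActive (s.1 x)) (hy : 1 ≤ numActive (s.1 y)) :
    topInstr V o x (topInstr V o' y s) = topInstr V o' y (topInstr V o x s) := by
  obtain ⟨σ, m⟩ := s
  obtain ⟨k, hk⟩ := exists_active hx
  obtain ⟨l, hl⟩ := exists_active hy
  simp only at hk hl
  have hyx := hxy.symm
  refine Prod.ext ?_ ?_
  · funext w
    rcases o with _ | z <;> rcases o' with _ | z'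
    · by_cases hwx : w = x <;> by_cases hwy : w = y <;> 
        rcases k with _ | k <;> rcases l with _ | l <;>
        simp_all [topInstr, numActive, Function.update_apply]
    · simp only [topInstr]
      generalize hv : y + z' = v
      by_cases h2 : v ∈ V <;> rcases k with _ | k <;>
        simp only [h2, if_true, if_false, Function.update_apply, hk, hl, hxy, hyx, numActive] <;>
        grind [addParticle, numActive]
    · simp only [topInstr]
      generalize hv : x + z = v
      by_cases h2 : v ∈ V <;> rcases l with _ | l <;>
        simp only [h2, if_true, if_false, Function.update_apply, hk, hl, hxy, hyx, numActive] <;>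
        grind [addParticle, numActive]
    · simp only [topInstr]
      generalize hu : x + z = u
      generalize hv : y + z' = v
      by_cases h1 : u ∈ V <;> by_cases h2 : v ∈ V <;> 
        simp only [h1, h2, if_true, if_false, Function.update_apply, hk, hl, hxy, hyx] <;>
        grind [addParticle, numActive]
  · funext w
    simp only [topInstr, Function.update_apply]
    grind

lemma topple_comm {d : ℕ} (V : Finset (Site d)) (I : Stacks d) {x y : Site d} (hxy : x ≠ y)
    (s : State d) (hx : 1 ≤ numActive (s.1 x)) (hy : 1 ≤ numActive (s.1 y)) :
    topple V I x (topple V I y s) = topple V I y (topple V I x s) := by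
  rw [topple_eq V I x (topple V I y s), topple_eq V I y (topple V I x s), topple_odom, topple_odom,
    topple_eq, topple_eq, Function.update_of_ne hxy, Function.update_of_ne hxy.symm]
  exact topInstr_comm V hxy _ _ s hx hy

lemma run_append {d : ℕ} (V : Finset (Site d)) (I : Stacks d) (s : State d)
    (a b : List (Site d)) : run V I s (a ++ b) = run V I (run V I s a) b := by
  induction a generalizing s with
  | nil => rfl
  | cons x a ih => exact ih _

lemma move_front {d : ℕ} (V : Finset (Site d)) (I : Stacks d) (x : Site d) (hxV : x ∈ V)
    (a b : List (Site d)) :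
    ∀ s : State d, 1 ≤ numActive (s.1 x) → x ∉ a → Legal V I s (a ++ x :: b) →
      Legal V I (topple V I x s) (a ++ b) ∧
        run V I s (a ++ x :: b) = run V I (topple V I x s) (a ++ b) := by
  induction a with
  | nil => intro s hs _ hl; exact ⟨hl.2.2, rfl⟩
  | cons y a ih =>
    intro s hs hxa hl
    have hxy : y ≠ x := fun h => hxa (by simp [h])
    have hxa' : x ∉ a := fun h => hxa (by simp [h])
    obtain ⟨hyV, hy, hl⟩ := hl
    have h := ih _ (hs.trans (numActive_topple V I hxy s)) hxa' hl
    rw [topple_comm V I hxy.symm s hs hy] at h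
    exact ⟨⟨hyV, hy.trans (numActive_topple V I hxy.symm s), h.1⟩, h.2⟩

lemma mem_of_stable {d : ℕ} (V : Finset (Site d)) (I : Stacks d) (x : Site d) (hxV : x ∈ V)
    (l : List (Site d)) : ∀ s : State d, 1 ≤ numActive (s.1 x) →
      Stable V (run V I s l).1 → x ∈ l := by
  induction l with
  | nil => intro s hs hst; have := hst x hxV; simp only [run] at this; omega
  | cons y l ih =>
    intro s hs hst
    by_cases hxy : y = x
    · simp [hxy]
    · exact List.mem_cons_of_mem _ (ih _ (hs.trans (numActive_topple V I hxy s)) hst)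

/-- The abelian property: the stabilization is unique. -/
theorem abelian {d : ℕ} (V : Finset (Site d)) (I : Stacks d) (l : List (Site d)) :
    ∀ (s : State d) (l' : List (Site d)), Legal V I s l → Stable V (run V I s l).1 →
      Legal V I s l' → Stable V (run V I s l').1 → run V I s l = run V I s l' := by
  induction l with
  | nil =>
    intro s l' _ hst hl' _
    cases l' with
    | nil => rfl
    | cons y l' =>
      have := hst y hl'.1
      have := hl'.2.1
      simp only [run] at *
      omega
  | cons x l ih =>
    intro s l' hl hst hl' hst'
    have hx := mem_of_stable V I x hl.1 l' s hl.2.1 hst'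
    obtain ⟨a, b, rfl, hxa⟩ := List.eq_append_cons_of_mem hx
    obtain ⟨h1, h2⟩ := move_front V I x hl.1 a b s hl.2.1 hxa hl'
    rw [h2] at hst' ⊢
    exact ih _ _ hl.2.2 hst h1 hst'

/-! ### Translations -/

/-- The site `x` is sleeping in the stabilization. -/
def StabSleep {d : ℕ} (x : Site d) (V : Finset (Site d)) (I : Stacks d) (η : Site d → ℕ) : Prop :=
  ∃ l, Legal V I (initState d V η) l ∧ Stable V (run V I (initState d V η) l).1 ∧
    (run V I (initState d V η) l).1 x = .sleeping

/-- The odometer at `x` is at least `K`. -/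
def OdomGe {d : ℕ} (x : Site d) (K : ℕ) (I : Stacks d) (η : Site d → ℕ) : Prop :=
  ∃ V l, Legal V I (initState d V η) l ∧ K ≤ l.count x

lemma StabSleep.sleepAt0 {d : ℕ} {V : Finset (Site d)} {I : Stacks d} {η : Site d → ℕ}
    (h : StabSleep 0 V I η) : SleepAt0 V I η := by
  obtain ⟨l, hl, hst, h0⟩ := h
  have hc : StabCompletes V I η := ⟨l, hl, hst⟩
  refine ⟨hc, ?_⟩
  unfold stabConfig
  rw [dif_pos hc, ← abelian V I l _ _ hl hst hc.choose_spec.1 hc.choose_spec.2, h0]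

/-- Translation of the stacks. -/
def tauI {d : ℕ} (y : Site d) (I : Stacks d) : Stacks d := fun p => I (p.1 + y, p.2)

/-- Translation of states. -/
def tauS {d : ℕ} (y : Site d) (s : State d) : State d := (fun x => s.1 (x + y), fun x => s.2 (x + y))

/-- Translation of finite sets. -/
noncomputable def tauV {d : ℕ} (y : Site d) (V : Finset (Site d)) : Finset (Site d) :=
  V.image (fun x => x - y)

lemma mem_tauV {d : ℕ} (y : Site d) (V : Finset (Site d)) (x : Site d) :
    x ∈ tauV y V ↔ x + y ∈ V := by
  simp only [tauV, Finset.mem_image]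
  constructor
  · rintro ⟨a, ha, rfl⟩; simpa using ha
  · intro h; exact ⟨_, h, by simp⟩

lemma tau_topple {d : ℕ} (y : Site d) (V : Finset (Site d)) (I : Stacks d) (x : Site d)
    (s : State d) : tauS y (topple V I x s) = topple (tauV y V) (tauI y I) (x - y) (tauS y s) := by
  have hI : tauI y I (x - y, (tauS y s).2 (x - y)) = I (x, s.2 x) := by simp [tauI, tauS]
  rw [topple_eq, topple_eq, hI]
  refine Prod.ext ?_ ?_
  · funext w
    rcases I (x, s.2 x) with _ | z
    · have e : (tauS y s).1 (x - y) = s.1 x := by simp [tauS]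
      simp only [topInstr, e]
      split_ifs <;> simp [tauS, Function.update_apply, eq_sub_iff_add_eq]
    · simp only [topInstr, tauS, mem_tauV]
      have e : x - y + z + y = x + z := by abel
      rw [sub_add_cancel, e]
      have e1 : ∀ w : Site d, w = x - y + z ↔ w + y = x + z := fun w => by
        rw [← e]; simp
      split_ifs <;> simp [Function.update_apply, eq_sub_iff_add_eq, e1, e]
  · funext w
    simp [topInstr, tauS, Function.update_apply, eq_sub_iff_add_eq]

lemma tau_run {d : ℕ} (y : Site d) (V : Finset (Site d)) (I : Stacks d) (l : List (Site d)) :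
    ∀ s : State d, tauS y (run V I s l) =
      run (tauV y V) (tauI y I) (tauS y s) (l.map (fun x => x - y)) := by
  induction l with
  | nil => intro s; rfl
  | cons x l ih => intro s; simp only [run, List.map_cons]; rw [ih, tau_topple]

lemma tau_legal {d : ℕ} (y : Site d) (V : Finset (Site d)) (I : Stacks d) (l : List (Site d)) :
    ∀ s : State d, Legal V I s l →
      Legal (tauV y V) (tauI y I) (tauS y s) (l.map (fun x => x - y)) := by
  induction l with
  | nil => intro s _; trivial
  | cons x l ih =>
    intro s hl
    simp only [Legal, List.map_cons]
    refine ⟨by rw [mem_tauV]; simpa using hl.1, by simpa [tauS] using hl.2.1, ?_⟩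
    rw [← tau_topple]
    exact ih _ hl.2.2

lemma tau_init {d : ℕ} (y : Site d) (V : Finset (Site d)) (η : Site d → ℕ) :
    tauS y (initState d V η) = initState d (tauV y V) (shift y η) := by
  simp only [tauS, initState, mem_tauV, shift]

lemma tau_stabSleep {d : ℕ} (y : Site d) {V : Finset (Site d)} {I : Stacks d} {η : Site d → ℕ}
    (h : StabSleep y V I η) : StabSleep 0 (tauV y V) (tauI y I) (shift y η) := by
  obtain ⟨l, hl, hst, h0⟩ := h
  refine ⟨l.map (fun x => x - y), ?_, ?_, ?_⟩
  · rw [← tau_init]; exact tau_legal y V I l _ hl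
  · rw [← tau_init, ← tau_run]
    intro x hx
    exact hst _ ((mem_tauV y V x).1 hx)
  · rw [← tau_init, ← tau_run]
    simpa [tauS] using h0

lemma tau_odomGe {d : ℕ} (y : Site d) {K : ℕ} {I : Stacks d} {η : Site d → ℕ}
    (h : OdomGe y K I η) : OdomGe 0 K (tauI y I) (shift y η) := by
  obtain ⟨V, l, hl, hc⟩ := h
  refine ⟨tauV y V, l.map (fun x => x - y), ?_, ?_⟩
  · rw [← tau_init]; exact tau_legal y V I l _ hl
  · have := List.count_map_of_injective l (fun x : Site d => x - y) sub_left_injective y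
    simp only [sub_self] at this
    rwa [this]

lemma odom0_eq_top {d : ℕ} {I : Stacks d} {η : Site d → ℕ} (h : ∀ K, OdomGe 0 K I η) :
    odom0 I η = ⊤ := by
  rw [ENat.eq_top_iff_forall_ge]
  intro K
  obtain ⟨V, l, hl, hc⟩ := h K
  unfold odom0
  refine le_trans ?_ (le_iSup_of_le V (le_iSup_of_le l (le_iSup_of_le hl le_rfl)))
  convert (Nat.cast_le (α := ℕ∞)).2 hc

end ARW

open MeasureTheory ENNReal Filter

namespace ARW

/-! ### The law of the stacks -/

/-- Basic hypotheses on the parameters. -/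
structure Params (d : ℕ) (step : Site d → ℝ) (lam : ℝ) : Prop where
  nonneg : ∀ z, 0 ≤ step z
  sum : HasSum step 1
  pos : 0 < lam

lemma Params.tsum_step {d : ℕ} {step : Site d → ℝ} {lam : ℝ} (hp : Params d step lam) :
    ∑' z, ENNReal.ofReal (step z) = 1 := by
  rw [← ENNReal.ofReal_tsum_of_nonneg hp.nonneg hp.sum.summable, hp.sum.tsum_eq, ENNReal.ofReal_one]

lemma Params.lam_add {d : ℕ} {step : Site d → ℝ} {lam : ℝ} (hp : Params d step lam) :
    ENNReal.ofReal (lamS lam) + ENNReal.ofReal (lamJ lam) = 1 := by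
  have := hp.pos
  rw [← ENNReal.ofReal_add (by unfold lamS; positivity) (by unfold lamJ; positivity)]
  have : lamS lam + lamJ lam = 1 := by unfold lamS lamJ; field_simp; ring
  rw [this, ENNReal.ofReal_one]

lemma tsum_option {β : Type*} (f : Option β → ℝ≥0∞) : ∑' o, f o = f none + ∑' z, f (some z) := by
  rw [← (Equiv.optionEquivSumPUnit.{0} β).symm.tsum_eq f, ENNReal.summable.tsum_sum
    ENNReal.summable]
  simp [add_comm]

lemma Params.tsum_weight {d : ℕ} {step : Site d → ℝ} {lam : ℝ} (hp : Params d step lam) :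
    ∑' o, instrWeight step lam o = 1 := by
  rw [tsum_option]
  simp only [instrWeight]
  rw [ENNReal.tsum_mul_left, hp.tsum_step, mul_one, hp.lam_add]

/-- The instruction law. -/
noncomputable def kap {d : ℕ} (step : Site d → ℝ) (lam : ℝ) : Measure (Instr d) :=
  Measure.sum (fun o => instrWeight step lam o • Measure.dirac o)

lemma lintegral_kap {d : ℕ} (step : Site d → ℝ) (lam : ℝ) (f : Instr d → ℝ≥0∞) :
    ∫⁻ o, f o ∂(kap step lam) = ∑' o, instrWeight step lam o * f o := by
  unfold kap
  rw [lintegral_sum_measure]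
  simp

lemma kap_singleton {d : ℕ} (step : Site d → ℝ) (lam : ℝ) (o : Instr d) :
    kap step lam {o} = instrWeight step lam o := by
  classical
  rw [← lintegral_indicator_one (MeasurableSet.of_discrete (s := {o})), lintegral_kap, tsum_eq_single o]
  · simp
  · intro b hb; simp [hb]

lemma Params.prob_kap {d : ℕ} {step : Site d → ℝ} {lam : ℝ} (hp : Params d step lam) :
    IsProbabilityMeasure (kap step lam) := by
  constructor
  rw [← lintegral_one, lintegral_kap]
  simpa using hp.tsum_weight

lemma cyl_eq_pi {d : ℕ} (F : Finset (Site d × ℕ)) (g : Site d × ℕ → Instr d) :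
    {I : Stacks d | ∀ i ∈ F, I i = g i} = Set.pi (F : Set (Site d × ℕ)) (fun i => {g i}) := by
  ext I; simp [Set.mem_pi]

lemma measurableSet_cyl {d : ℕ} (F : Finset (Site d × ℕ)) (g : Site d × ℕ → Instr d) :
    MeasurableSet {I : Stacks d | ∀ i ∈ F, I i = g i} := by
  rw [cyl_eq_pi]
  exact MeasurableSet.pi F.countable_toSet (fun _ _ => MeasurableSet.of_discrete)

lemma Params.isStackLaw {d : ℕ} {step : Site d → ℝ} {lam : ℝ} (hp : Params d step lam) :
    IsStackLaw d step lam (stackLaw d step lam) := by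
  have := hp.prob_kap
  have h : ∃ μ, IsStackLaw d step lam μ := by
    refine ⟨Measure.infinitePi (fun _ => kap step lam), inferInstance, fun F g => ?_⟩
    rw [cyl_eq_pi, Measure.infinitePi_pi _ (fun _ _ => MeasurableSet.of_discrete)]
    simp [kap_singleton]
  unfold stackLaw
  rw [dif_pos h]
  exact h.choose_spec

lemma IsStackLaw.unique {d : ℕ} {step : Site d → ℝ} {lam : ℝ} {μ ν : Measure (Stacks d)}
    (hμ : IsStackLaw d step lam μ) (hν : IsStackLaw d step lam ν) : μ = ν := by
  classical
  have := hμ.1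
  have := hν.1
  have h1 : IsProjectiveLimit μ (fun F : Finset (Site d × ℕ) => μ.map F.restrict) := fun F => rfl
  have (F : Finset (Site d × ℕ)) : IsFiniteMeasure (μ.map F.restrict) := inferInstance
  refine h1.unique (fun F => ?_)
  have hm : Measurable (F.restrict (π := fun _ : Site d × ℕ => Instr d)) := F.measurable_restrict
  refine Measure.ext_of_singleton fun g => ?_
  rw [Measure.map_apply hm (MeasurableSet.singleton g),
    Measure.map_apply hm (MeasurableSet.singleton g)]
  have e : F.restrict (π := fun _ : Site d × ℕ => Instr d) ⁻¹' {g} =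
      {I : Stacks d | ∀ i ∈ F, I i = (fun i => if h : i ∈ F then g ⟨i, h⟩ else none) i} := by
    ext I
    simp only [Set.mem_preimage, Set.mem_singleton_iff, Set.mem_ofPred_eq, funext_iff]
    constructor
    · intro h i hi; simpa [hi] using h ⟨i, hi⟩
    · intro h i; simpa [i.2] using h i i.2
  rw [e, hμ.2, hν.2]

lemma Params.resample {d : ℕ} {step : Site d → ℝ} {lam : ℝ} (hp : Params d step lam)
    (j : Site d × ℕ) :
    Measure.map (fun p : Instr d × Stacks d => Function.update p.2 j p.1)
      ((kap step lam).prod (stackLaw d step lam)) = stackLaw d step lam := by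
  classical
  have := hp.prob_kap
  have hl := hp.isStackLaw
  have := hl.1
  have hm : Measurable (fun p : Instr d × Stacks d => Function.update p.2 j p.1) := by
    refine measurable_pi_lambda _ fun i => ?_
    by_cases h : i = j
    · subst h; simpa using measurable_fst
    · simp only [Function.update_of_ne h]
      exact (measurable_pi_apply i).comp measurable_snd
  refine IsStackLaw.unique ⟨Measure.isProbabilityMeasure_map hm.aemeasurable, fun F g => ?_⟩ hl
  rw [Measure.map_apply hm (measurableSet_cyl F g)]
  by_cases hj : j ∈ F
  · have e : (fun p : Instr d × Stacks d => Function.update p.2 j p.1) ⁻¹'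
        {I : Stacks d | ∀ i ∈ F, I i = g i} =
        {g j} ×ˢ {I : Stacks d | ∀ i ∈ F.erase j, I i = g i} := by
      ext p
      simp only [Set.mem_preimage, Set.mem_ofPred_eq, Set.mem_prod, Set.mem_singleton_iff,
        Finset.mem_erase]
      constructor
      · intro h
        refine ⟨by simpa using h j hj, fun i hi => ?_⟩
        simpa [Function.update_of_ne hi.1] using h i hi.2
      · rintro ⟨h1, h2⟩ i hi
        by_cases hij : i = j
        · subst hij; simpa using h1
        · simpa [Function.update_of_ne hij] using h2 i ⟨hij, hi⟩
    rw [e, Measure.prod_prod, hl.2, kap_singleton]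
    exact Finset.mul_prod_erase F (fun i => instrWeight step lam (g i)) hj
  · have e : (fun p : Instr d × Stacks d => Function.update p.2 j p.1) ⁻¹'
        {I : Stacks d | ∀ i ∈ F, I i = g i} =
        Set.univ ×ˢ {I : Stacks d | ∀ i ∈ F, I i = g i} := by
      ext p
      simp only [Set.mem_preimage, Set.mem_ofPred_eq, Set.mem_prod, Set.mem_univ, true_and]
      refine forall₂_congr fun i hi => ?_
      have hij : i ≠ j := fun h => hj (h ▸ hi)
      rw [Function.update_of_ne hij]
    rw [e, Measure.prod_prod, hl.2, measure_univ, one_mul]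

lemma measurable_tauI {d : ℕ} (y : Site d) : Measurable (tauI y) :=
  measurable_pi_lambda _ fun _ => measurable_pi_apply _

lemma Params.map_tau {d : ℕ} {step : Site d → ℝ} {lam : ℝ} (hp : Params d step lam)
    (y : Site d) : Measure.map (tauI y) (stackLaw d step lam) = stackLaw d step lam := by
  classical
  have hl := hp.isStackLaw
  have := hl.1
  have hm := measurable_tauI y
  refine IsStackLaw.unique ⟨Measure.isProbabilityMeasure_map hm.aemeasurable, fun F g => ?_⟩ hl
  rw [Measure.map_apply hm (measurableSet_cyl F g)]
  let e : Site d × ℕ ↪ Site d × ℕ := ⟨fun p => (p.1 + y, p.2), fun p q h => by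
    simp only [Prod.mk.injEq] at h; exact Prod.ext (add_right_cancel h.1) h.2⟩
  have he : ∀ p, e p = (p.1 + y, p.2) := fun p => rfl
  have : tauI y ⁻¹' {I : Stacks d | ∀ i ∈ F, I i = g i} =
      {I : Stacks d | ∀ i ∈ F.map e, I i = g (i.1 - y, i.2)} := by
    ext I
    simp only [Set.mem_preimage, Set.mem_ofPred_eq, Finset.mem_map, forall_exists_index, and_imp,
      forall_apply_eq_imp_iff₂, he, tauI]
    simp
  rw [this, hl.2, Finset.prod_map]
  simp [he]

lemma Params.tau_le {d : ℕ} {step : Site d → ℝ} {lam : ℝ} (hp : Params d step lam)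
    (y : Site d) (S : Set (Stacks d)) :
    stackLaw d step lam {I | tauI y I ∈ S} ≤ stackLaw d step lam S := by
  calc _ ≤ Measure.map (tauI y) (stackLaw d step lam) S :=
        Measure.le_map_apply (measurable_tauI y).aemeasurable S
    _ = _ := by rw [hp.map_tau]

end ARW

open MeasureTheory ENNReal Filter

namespace ARW

/-! ### The labelled toppling process -/

/-- Labelled particles: positions and remaining number of counted jumps, together with the number
of counted jumps from each site. -/
abbrev Aux (d : ℕ) (ι : Type) := (ι → Site d × ℕ) × (Site d → ℕ)

/-- Augmented states. -/
abbrev Aug (d : ℕ) (ι : Type) := State d × Aux d ι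

open Classical in
/-- Moving a labelled particle from `x` by `z`. -/
noncomputable def auxStep {d : ℕ} {ι : Type} (x z : Site d) (q : Aux d ι) : Aux d ι :=
  if h : ∃ i, (q.1 i).1 = x then
    (Function.update q.1 h.choose (x + z, (q.1 h.choose).2 - 1),
      if 0 < (q.1 h.choose).2 then Function.update q.2 x (q.2 x + 1) else q.2)
  else q

/-- Augmented toppling. -/
noncomputable def stepA {d : ℕ} {ι : Type} (V : Finset (Site d)) (x : Site d) (a : Aug d ι)
    (o : Instr d) : Aug d ι :=
  (topInstr V o x a.1, match o with
    | none => a.2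
    | some z => auxStep x z a.2)

open Classical in
/-- Choice of an unstable site. -/
noncomputable def pick {d : ℕ} (V : Finset (Site d)) (σ : Config d) : Option (Site d) :=
  if h : ∃ x, x ∈ V ∧ 1 ≤ numActive (σ x) then some h.choose else none

lemma pick_some {d : ℕ} {V : Finset (Site d)} {σ : Config d} {x : Site d}
    (h : pick V σ = some x) : x ∈ V ∧ 1 ≤ numActive (σ x) := by
  unfold pick at h
  split_ifs at h with h'
  simp only [Option.some.injEq] at h
  exact h ▸ h'.choose_spec

lemma pick_none {d : ℕ} {V : Finset (Site d)} {σ : Config d}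
    (h : pick V σ = none) : Stable V σ := by
  unfold pick at h
  split_ifs at h with h'
  intro x hx
  by_contra hc
  exact h' ⟨x, hx, by omega⟩

/-- `T` steps of the augmented process. -/
noncomputable def runA {d : ℕ} {ι : Type} (V : Finset (Site d)) (I : Stacks d) :
    ℕ → Aug d ι → Aug d ι
  | 0, a => a
  | T + 1, a =>
    match pick V a.1.1 with
    | none => a
    | some x => runA V I T (stepA V x a (I (x, a.1.2 x)))

lemma runA_none {d : ℕ} {ι : Type} {V : Finset (Site d)} {I : Stacks d} {T : ℕ} {a : Aug d ι}
    (h : pick V a.1.1 = none) : runA V I (T + 1) a = a := by simp [runA, h]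

lemma runA_some {d : ℕ} {ι : Type} {V : Finset (Site d)} {I : Stacks d} {T : ℕ} {a : Aug d ι}
    {x : Site d} (h : pick V a.1.1 = some x) :
    runA V I (T + 1) a = runA V I T (stepA V x a (I (x, a.1.2 x))) := by simp [runA, h]

lemma auxStep_W {d : ℕ} {ι : Type} (x z y : Site d) (q : Aux d ι) :
    (auxStep x z q).2 y ≤ q.2 y + if x = y then 1 else 0 := by
  unfold auxStep
  split_ifs with h1 h2 h3 <;> simp [Function.update_apply] <;> grind

lemma stepA_W {d : ℕ} {ι : Type} (V : Finset (Site d)) (x y : Site d) (a : Aug d ι) (o : Instr d) :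
    (stepA V x a o).2.2 y ≤ a.2.2 y + if x = y then 1 else 0 := by
  cases o with
  | none => simp [stepA]
  | some z => exact auxStep_W x z y a.2

lemma runA_spec {d : ℕ} {ι : Type} (V : Finset (Site d)) (I : Stacks d) (T : ℕ) :
    ∀ a : Aug d ι, ∃ l, Legal V I a.1 l ∧ (runA V I T a).1 = run V I a.1 l ∧
      (∀ y, (runA V I T a).2.2 y ≤ a.2.2 y + l.count y) ∧
      (l.length = T ∨ Stable V (runA V I T a).1.1) ∧ ∀ x ∈ l, x ∈ V := by
  induction T with
  | zero => intro a; exact ⟨[], trivial, rfl, fun y => by simp [runA], Or.inl rfl, by simp⟩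
  | succ T ih =>
    intro a
    rcases h : pick V a.1.1 with _ | x
    · rw [runA_none h]
      exact ⟨[], trivial, rfl, fun y => by simp, Or.inr (pick_none h), by simp⟩
    · rw [runA_some h]
      obtain ⟨l, h1, h2, h3, h4, h5⟩ := ih (stepA V x a (I (x, a.1.2 x)))
      have e : (stepA V x a (I (x, a.1.2 x))).1 = topple V I x a.1 := (topple_eq V I x a.1).symm
      rw [e] at h1 h2
      refine ⟨x :: l, ⟨(pick_some h).1, (pick_some h).2, h1⟩, h2, fun y => ?_, ?_, ?_⟩
      · have := h3 y
        have := stepA_W V x y a (I (x, a.1.2 x))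
        rw [List.count_cons]
        by_cases hxy : x = y <;> simp [hxy] at * <;> omega
      · rcases h4 with h4 | h4
        · exact Or.inl (by simp [h4])
        · exact Or.inr h4
      · simpa [(pick_some h).1] using h5

/-- The process only depends on the unused instructions. -/
lemma runA_update {d : ℕ} {ι : Type} (V : Finset (Site d)) (I : Stacks d) (j : Site d × ℕ)
    (o : Instr d) (T : ℕ) :
    ∀ a : Aug d ι, j.2 < a.1.2 j.1 → runA V (Function.update I j o) T a = runA V I T a := by
  induction T with
  | zero => intro a _; rfl
  | succ T ih =>
    intro a ha
    rcases h : pick V a.1.1 with _ | x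
    · rw [runA_none h, runA_none h]
    · rw [runA_some h, runA_some h]
      have hne : (x, a.1.2 x) ≠ j := by
        rintro rfl
        simp at ha
      rw [Function.update_of_ne hne]
      apply ih
      simp only [stepA, topInstr, Function.update_apply]
      split_ifs with hj
      · rw [hj] at ha; omega
      · exact ha

lemma measurable_runA {d : ℕ} {ι : Type} (V : Finset (Site d)) (g : Aug d ι → ℝ≥0∞) (T : ℕ) :
    ∀ a : Aug d ι, Measurable (fun I => g (runA V I T a)) := by
  induction T with
  | zero => intro a; simp only [runA]; exact measurable_const
  | succ T ih =>
    intro a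
    rcases h : pick V a.1.1 with _ | x
    · simp only [runA_none h]; exact measurable_const
    · simp only [runA_some h]
      have h1 : Measurable (fun p : Instr d × Stacks d => g (runA V p.2 T (stepA V x a p.1))) :=
        measurable_from_prod_countable_right (fun o => by simpa using ih (stepA V x a o))
      have h2 : Measurable (fun I : Stacks d => (I (x, a.1.2 x), I)) :=
        (measurable_pi_apply (x, a.1.2 x)).prodMk measurable_id
      exact h1.comp h2

/-- Supermartingale bound. -/
lemma Params.super {d : ℕ} {step : Site d → ℝ} {lam : ℝ} (hp : Params d step lam) {ι : Type}
    (V : Finset (Site d)) (g : Aux d ι → ℝ≥0∞)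
    (hg : ∀ q x, x ∈ V → ∑' z, ENNReal.ofReal (step z) * g (auxStep x z q) ≤ g q) (T : ℕ) :
    ∀ a : Aug d ι, ∫⁻ I, g (runA V I T a).2 ∂(stackLaw d step lam) ≤ g a.2 := by
  have := hp.prob_kap
  have := hp.isStackLaw.1
  induction T with
  | zero => intro a; simp [runA]
  | succ T ih =>
    intro a
    rcases h : pick V a.1.1 with _ | x
    · simp only [runA_none h]; simp
    · have hm := measurable_runA V (fun b : Aug d ι => g b.2) (T + 1) a
      have hm2 : Measurable (fun p : Instr d × Stacks d =>
          Function.update p.2 (x, a.1.2 x) p.1) := by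
        refine measurable_pi_lambda _ fun i => ?_
        by_cases h : i = (x, a.1.2 x)
        · subst h; simpa using measurable_fst
        · simp only [Function.update_of_ne h]
          exact (measurable_pi_apply i).comp measurable_snd
      have hcm : Measurable (fun p : Instr d × Stacks d =>
          g (runA V (Function.update p.2 (x, a.1.2 x) p.1) (T + 1) a).2) := hm.comp hm2
      rw [← hp.resample (x, a.1.2 x), lintegral_map hm hm2, lintegral_prod _ hcm.aemeasurable]
      have e : ∀ o I, runA V (Function.update I (x, a.1.2 x) o) (T + 1) a =
          runA V I T (stepA V x a o) := by
        intro o I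
        rw [runA_some h, Function.update_self]
        apply runA_update
        simp [stepA, topInstr]
      simp only [e]
      refine (lintegral_mono fun o => ih (stepA V x a o)).trans ?_
      rw [lintegral_kap, tsum_option]
      simp only [instrWeight, stepA]
      have h2 : ∑' z, ENNReal.ofReal (lamJ lam) * ENNReal.ofReal (step z) * g (auxStep x z a.2)
          ≤ ENNReal.ofReal (lamJ lam) * g a.2 := by
        simp only [mul_assoc]
        rw [ENNReal.tsum_mul_left]
        gcongr
        exact hg _ _ (pick_some h).1
      calc _ ≤ ENNReal.ofReal (lamS lam) * g a.2 + ENNReal.ofReal (lamJ lam) * g a.2 := by gcongr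
        _ = g a.2 := by rw [← add_mul, hp.lam_add, one_mul]

/-! ### Invariants -/

/-- Number of particles. -/
def total : SiteState → ℕ
  | .active n => n
  | .sleeping => 1

/-- Invariants of the labelled process. -/
structure Inv {d : ℕ} {ι : Type} [Fintype ι] (V : Finset (Site d)) (n : ℕ) (a : Aug d ι) :
    Prop where
  cnt : ∀ w ∈ V, (∑ i, if (a.2.1 i).1 = w then 1 else 0) = total (a.1.1 w)
  le : ∀ i, (a.2.1 i).2 ≤ n
  sum : Fintype.card ι * n ≤ ∑ i, (a.2.1 i).2 + ∑ y ∈ V, a.2.2 y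

lemma sum_update {ι α M : Type*} [Fintype ι] [DecidableEq ι] [AddCommMonoid M] (f : α → M) (P : ι → α)
    (i : ι) (b : α) : ∑ j, f (Function.update P i b j) + f (P i) = ∑ j, f (P j) + f b := by
  rw [← Finset.add_sum_erase _ _ (Finset.mem_univ i),
    ← Finset.add_sum_erase _ (fun j => f (P j)) (Finset.mem_univ i)]
  have : ∑ j ∈ Finset.univ.erase i, f (Function.update P i b j) =
      ∑ j ∈ Finset.univ.erase i, f (P j) :=
    Finset.sum_congr rfl fun j hj => by rw [Function.update_of_ne (Finset.ne_of_mem_erase hj)]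
  rw [this, Function.update_self]
  abel

open Classical in
lemma auxStep_eq {d : ℕ} {ι : Type} (x z : Site d) (q : Aux d ι) :
    ((∀ i, (q.1 i).1 ≠ x) ∧ auxStep x z q = q) ∨
    ∃ i, (q.1 i).1 = x ∧ ∀ z, auxStep x z q = (Function.update q.1 i (x + z, (q.1 i).2 - 1),
      if 0 < (q.1 i).2 then Function.update q.2 x (q.2 x + 1) else q.2) := by
  by_cases h : ∃ i, (q.1 i).1 = x
  · right
    refine ⟨h.choose, h.choose_spec, fun z => ?_⟩
    unfold auxStep
    rw [dif_pos h]
  · left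
    refine ⟨fun i hi => h ⟨i, hi⟩, ?_⟩
    unfold auxStep
    rw [dif_neg h]

lemma total_top {d : ℕ} {V : Finset (Site d)} {s : State d} {x w : Site d} {k : ℕ} (z : Site d)
    (hk : s.1 x = .active (k + 1)) (hw : w ∈ V) :
    total ((topInstr V (some z) x s).1 w) + (if x = w then 1 else 0) =
      total (s.1 w) + (if x + z = w then 1 else 0) := by
  have hadd : ∀ t, total (addParticle t) = total t + 1 := by
    intro t; cases t <;> rfl
  have h1 : total (Function.update s.1 x (SiteState.active (numActive (s.1 x) - 1)) w) +
      (if x = w then 1 else 0) = total (s.1 w) := by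
    by_cases hxw : x = w
    · subst hxw; simp [hk, numActive, total]
    · rw [Function.update_of_ne (Ne.symm hxw)]; simp [hxw]
  simp only [topInstr]
  by_cases hu : x + z ∈ V
  · rw [if_pos hu]
    by_cases hxz : x + z = w
    · rw [hxz, Function.update_self, hadd, if_pos rfl]
      omega
    · rw [Function.update_of_ne (Ne.symm hxz), if_neg hxz]
      omega
  · rw [if_neg hu]
    have : ¬ (x + z = w) := fun e => hu (e ▸ hw)
    rw [if_neg this]
    omega

lemma Inv.stepA {d : ℕ} {ι : Type} [Fintype ι] {V : Finset (Site d)} {n : ℕ} {a : Aug d ι}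
    (h : Inv V n a) {x : Site d} (hx : x ∈ V) (hn : 1 ≤ numActive (a.1.1 x)) (o : Instr d) :
    Inv V n (stepA V x a o) := by
  classical
  obtain ⟨k, hk⟩ := exists_active hn
  rcases o with _ | z
  · refine ⟨fun w hw => ?_, h.le, h.sum⟩
    refine (h.cnt w hw).trans ?_
    change total (a.1.1 w) = total ((topInstr V none x a.1).1 w)
    simp only [topInstr]
    split_ifs with h1
    · by_cases hwx : w = x
      · subst hwx
        rw [hk] at h1 ⊢
        simp only [numActive] at h1
        simp [total, h1]
      · rw [Function.update_of_ne hwx]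
    · rfl
  · have hc := h.cnt x hx
    rw [hk] at hc
    rcases auxStep_eq x z a.2 with ⟨h1, _⟩ | ⟨i, hi, h2⟩
    · simp [h1, total] at hc
    · have h2 := h2 z
      refine ⟨fun w hw => ?_, fun j => ?_, ?_⟩
      · have hw' := h.cnt w hw
        have hs := sum_update (fun p : Site d × ℕ => if p.1 = w then 1 else 0) a.2.1 i
          (x + z, (a.2.1 i).2 - 1)
        have ht := total_top z hk (V := V) hw
        have e : (ARW.stepA V x a (some z)).2.1 = Function.update a.2.1 i (x + z, (a.2.1 i).2 - 1) := by
          simp only [ARW.stepA, h2]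
        rw [e]
        change _ = total ((topInstr V (some z) x a.1).1 w)
        rw [hw'] at hs
        simp only [hi] at hs
        omega
      · have := h.le
        simp only [ARW.stepA, h2, Function.update_apply]
        split_ifs with hj
        · have := h.le i
          simp only; omega
        · exact this j
      · have hs := sum_update (fun p : Site d × ℕ => p.2) a.2.1 i (x + z, (a.2.1 i).2 - 1)
        have := h.sum
        simp only [ARW.stepA, h2]
        simp only at hs
        split_ifs with hr
        · rw [Finset.sum_update_of_mem hx]
          rw [← Finset.add_sum_erase _ _ hx] at this
          rw [Finset.sdiff_singleton_eq_erase]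
          omega
        · omega

lemma Inv.runA {d : ℕ} {ι : Type} [Fintype ι] {V : Finset (Site d)} {n : ℕ} (I : Stacks d) (T : ℕ) :
    ∀ {a : Aug d ι}, Inv V n a → Inv V n (runA V I T a) := by
  induction T with
  | zero => intro a h; exact h
  | succ T ih =>
    intro a ha
    rcases h : pick V a.1.1 with _ | x
    · rwa [runA_none h]
    · rw [runA_some h]
      exact ih (ha.stepA (pick_some h).1 (pick_some h).2 _)

open Classical in
/-- The deterministic mass balance. -/
lemma Inv.balance {d : ℕ} {ι : Type} [Fintype ι] {V : Finset (Site d)} {n : ℕ} {a : Aug d ι}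
    (h : Inv V n a) :
    Fintype.card ι * n ≤ ∑ y ∈ V, a.2.2 y +
      n * ∑ x ∈ V, (if Stable V a.1.1 ∧ a.1.1 x = .sleeping then 1 else 0) +
      n * (Fintype.card ι * if Stable V a.1.1 then 0 else 1) +
      n * ∑ i, (if (a.2.1 i).1 ∉ V ∧ 0 < (a.2.1 i).2 then 1 else 0) := by
  have h1 : ∑ i, (a.2.1 i).2 ≤ n * ∑ i, (if (a.2.1 i).1 ∈ V then 1 else 0) +
      n * ∑ i, (if (a.2.1 i).1 ∉ V ∧ 0 < (a.2.1 i).2 then 1 else 0) := by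
    rw [← mul_add, ← Finset.sum_add_distrib, Finset.mul_sum]
    refine Finset.sum_le_sum fun i _ => ?_
    have := h.le i
    by_cases hV : (a.2.1 i).1 ∈ V <;> by_cases hr : 0 < (a.2.1 i).2 <;> simp [hV, hr] <;> omega
  have h2 : ∑ i, (if (a.2.1 i).1 ∈ V then 1 else 0) ≤
      ∑ x ∈ V, (if Stable V a.1.1 ∧ a.1.1 x = .sleeping then 1 else 0) +
      (Fintype.card ι * if Stable V a.1.1 then 0 else 1) := by
    by_cases hs : Stable V a.1.1
    · have e : ∀ i, (if (a.2.1 i).1 ∈ V then 1 else 0) =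
          ∑ w ∈ V, if (a.2.1 i).1 = w then 1 else 0 := fun i => by simp
      simp only [e, hs, true_and, if_true, mul_zero, add_zero]
      rw [Finset.sum_comm]
      refine Finset.sum_le_sum fun w hw => ?_
      have h3 := h.cnt w hw
      have h4 := hs w hw
      rcases hq : a.1.1 w with k | _
      · rw [hq] at h3 h4
        simp only [numActive] at h4
        subst h4
        simp only [total] at h3
        rw [h3]; simp
      · rw [hq] at h3
        simp only [total] at h3
        rw [h3]; simp
    · simp only [hs, if_false, false_and, Finset.sum_const_zero, zero_add, mul_one]
      refine (Finset.sum_le_card_nsmul _ _ 1 fun i _ => by split_ifs <;> simp).trans (by simp)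
  have h3 := h.sum
  have h4 := Nat.mul_le_mul_left n h2
  rw [mul_add] at h4
  omega

end ARW

open MeasureTheory ENNReal Filter

namespace ARW

/-! ### Potentials -/

lemma Params.smul_summable {d : ℕ} {step : Site d → ℝ} {lam : ℝ} (hp : Params d step lam)
    {f : Site d → ℝ} {C : ℝ} (h0 : ∀ z, 0 ≤ f z) (h1 : ∀ z, f z ≤ C) :
    Summable (fun z => step z * f z) :=
  Summable.of_nonneg_of_le (fun z => mul_nonneg (hp.nonneg z) (h0 z))
    (fun z => mul_le_mul_of_nonneg_left (h1 z) (hp.nonneg z)) (hp.sum.summable.mul_right C)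

lemma Params.tsum_nonneg {d : ℕ} {step : Site d → ℝ} {lam : ℝ} (hp : Params d step lam)
    {f : Site d → ℝ} (h0 : ∀ z, 0 ≤ f z) : 0 ≤ ∑' z, step z * f z :=
  _root_.tsum_nonneg fun z => mul_nonneg (hp.nonneg z) (h0 z)

lemma Params.tsum_le {d : ℕ} {step : Site d → ℝ} {lam : ℝ} (hp : Params d step lam)
    {f : Site d → ℝ} {C : ℝ} (h0 : ∀ z, 0 ≤ f z) (h1 : ∀ z, f z ≤ C) :
    ∑' z, step z * f z ≤ C := by
  calc ∑' z, step z * f z ≤ ∑' z, step z * C :=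
        (hp.smul_summable h0 h1).tsum_le_tsum
          (fun z => mul_le_mul_of_nonneg_left (h1 z) (hp.nonneg z)) (hp.sum.summable.mul_right C)
    _ = C := by rw [tsum_mul_right, hp.sum.tsum_eq, one_mul]

lemma Params.tsum_lin {d : ℕ} {step : Site d → ℝ} {lam : ℝ} (hp : Params d step lam)
    {f : Site d → ℝ} {C a b : ℝ} (h0 : ∀ z, 0 ≤ f z) (h1 : ∀ z, f z ≤ C)
    (h2 : ∀ z, 0 ≤ a + b * f z) :
    ∑' z, ENNReal.ofReal (step z) * ENNReal.ofReal (a + b * f z) =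
      ENNReal.ofReal (a + b * ∑' z, step z * f z) := by
  have hs := hp.smul_summable h0 h1
  have e : ∀ z, step z * (a + b * f z) = a * step z + b * (step z * f z) := fun z => by ring
  have hs2 : Summable (fun z => step z * (a + b * f z)) := by
    simp only [e]
    exact (hp.sum.summable.mul_left a).add (hs.mul_left b)
  simp only [← ENNReal.ofReal_mul (hp.nonneg _)]
  rw [← ENNReal.ofReal_tsum_of_nonneg (fun z => mul_nonneg (hp.nonneg z) (h2 z)) hs2]
  congr 1
  simp only [e]
  rw [(hp.sum.summable.mul_left a).tsum_add (hs.mul_left b), tsum_mul_left, tsum_mul_left,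
    hp.sum.tsum_eq, mul_one]

/-- Expected number of visits to `y` at times `< r`. -/
noncomputable def hpot {d : ℕ} (step : Site d → ℝ) (y : Site d) : ℕ → Site d → ℝ
  | 0, _ => 0
  | r + 1, x => (if x = y then 1 else 0) + ∑' z, step z * hpot step y r (x + z)

lemma Params.hpot_bd {d : ℕ} {step : Site d → ℝ} {lam : ℝ} (hp : Params d step lam)
    (y : Site d) (r : ℕ) : ∀ x, 0 ≤ hpot step y r x ∧ hpot step y r x ≤ r := by
  induction r with
  | zero => intro x; simp [hpot]
  | succ r ih =>
    intro x
    have h1 := hp.tsum_nonneg fun z => (ih (x + z)).1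
    have h2 := hp.tsum_le (fun z => (ih (x + z)).1) fun z => (ih (x + z)).2
    simp only [hpot]
    push_cast
    split_ifs <;> constructor <;> linarith

lemma Params.hpot_sum {d : ℕ} {step : Site d → ℝ} {lam : ℝ} (hp : Params d step lam)
    (y : Site d) (r : ℕ) : ∀ F : Finset (Site d), ∑ x ∈ F, hpot step y r x ≤ r := by
  induction r with
  | zero => intro x; simp [hpot]
  | succ r ih =>
    intro F
    simp only [hpot]
    rw [Finset.sum_add_distrib, ← Summable.tsum_finsetSum
      (fun x _ => hp.smul_summable (fun z => (hp.hpot_bd y r (x + z)).1)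
        fun z => (hp.hpot_bd y r (x + z)).2)]
    simp only [← Finset.mul_sum]
    have h1 : ∑ x ∈ F, (if x = y then (1 : ℝ) else 0) ≤ 1 := by
      rw [Finset.sum_ite_eq']; split_ifs <;> norm_num
    have h2 := hp.tsum_le (f := fun z => ∑ x ∈ F, hpot step y r (x + z)) (C := r)
      (fun z => Finset.sum_nonneg fun x _ => (hp.hpot_bd y r (x + z)).1) (fun z => by
        have := ih (F.map (addRightEmbedding z))
        simpa using this)
    push_cast
    linarith

/-- The quadratic potential. -/
noncomputable def quad {d : ℕ} {ι : Type} [Fintype ι] (step : Site d → ℝ) (y : Site d)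
    (q : Aux d ι) : ℝ :=
  ((q.2 y : ℝ) + ∑ i, hpot step y (q.1 i).2 (q.1 i).1) ^ 2 +
    ∑ i, (2 * ((q.1 i).2 : ℝ) * hpot step y (q.1 i).2 (q.1 i).1 -
      hpot step y (q.1 i).2 (q.1 i).1 ^ 2)

lemma Params.w_nonneg {d : ℕ} {step : Site d → ℝ} {lam : ℝ} (hp : Params d step lam)
    (y : Site d) (r : ℕ) (x : Site d) : 0 ≤ 2 * (r : ℝ) * hpot step y r x - hpot step y r x ^ 2 := by
  have := hp.hpot_bd y r x
  nlinarith

lemma Params.quad_nonneg {d : ℕ} {step : Site d → ℝ} {lam : ℝ} (hp : Params d step lam)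
    {ι : Type} [Fintype ι] (y : Site d) (q : Aux d ι) : 0 ≤ quad step y q :=
  add_nonneg (sq_nonneg _) (Finset.sum_nonneg fun i _ => hp.w_nonneg y _ _)

lemma Params.sq_le_quad {d : ℕ} {step : Site d → ℝ} {lam : ℝ} (hp : Params d step lam)
    {ι : Type} [Fintype ι] (y : Site d) (q : Aux d ι) : (q.2 y : ℝ) ^ 2 ≤ quad step y q := by
  have h1 : 0 ≤ ∑ i, hpot step y (q.1 i).2 (q.1 i).1 :=
    Finset.sum_nonneg fun i _ => (hp.hpot_bd y _ _).1
  have h2 : 0 ≤ ∑ i, (2 * ((q.1 i).2 : ℝ) * hpot step y (q.1 i).2 (q.1 i).1 -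
      hpot step y (q.1 i).2 (q.1 i).1 ^ 2) := Finset.sum_nonneg fun i _ => hp.w_nonneg y _ _
  unfold quad
  have h3 : (0 : ℝ) ≤ q.2 y := Nat.cast_nonneg _
  nlinarith

lemma Params.quad_super {d : ℕ} {step : Site d → ℝ} {lam : ℝ} (hp : Params d step lam)
    {ι : Type} [Fintype ι] (y : Site d) (q : Aux d ι) (x : Site d) :
    ∑' z, ENNReal.ofReal (step z) * ENNReal.ofReal (quad step y (auxStep x z q)) ≤
      ENNReal.ofReal (quad step y q) := by
  classical
  by_cases hx : ∃ i, (q.1 i).1 = x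
  swap
  · have e : ∀ z, auxStep x z q = q := fun z => by unfold auxStep; rw [dif_neg hx]
    simp only [e]
    rw [ENNReal.tsum_mul_right, hp.tsum_step, one_mul]
  rcases auxStep_eq x 0 q with ⟨h1, _⟩ | ⟨i, hi, h2⟩
  · exact absurd hx (by simpa using h1)
  have hH := fun b => sum_update (fun p : Site d × ℕ => hpot step y p.2 p.1) q.1 i b
  have hC := fun b => sum_update (fun p : Site d × ℕ => 2 * (p.2 : ℝ) * hpot step y p.2 p.1 -
      hpot step y p.2 p.1 ^ 2) q.1 i b
  simp only [hi] at hH hC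
  rcases hr : (q.1 i).2 with _ | r
  · rw [hr] at hH hC h2
    have e : ∀ z, quad step y (auxStep x z q) = quad step y q := by
      intro z
      have a1 := hH (x + z, 0)
      have a2 := hC (x + z, 0)
      simp only [hpot] at a1 a2
      rw [h2 z]
      unfold quad
      simp only [lt_irrefl, if_false, Nat.zero_sub]
      rw [add_right_cancel a1]
      congr 1
      linarith
    simp only [e]
    rw [ENNReal.tsum_mul_right, hp.tsum_step, one_mul]
  · rw [hr] at hH hC h2
    simp only [Nat.succ_pos, if_true, Nat.add_sub_cancel] at h2
    set δ : ℝ := if x = y then 1 else 0 with hδ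
    set e : ℝ := ∑' z, step z * hpot step y r (x + z) with he
    have hh : hpot step y (r + 1) x = δ + e := rfl
    set H := ∑ i, hpot step y (q.1 i).2 (q.1 i).1 with hHdef
    set C := ∑ i, (2 * ((q.1 i).2 : ℝ) * hpot step y (q.1 i).2 (q.1 i).1 -
      hpot step y (q.1 i).2 (q.1 i).1 ^ 2) with hCdef
    set W : ℝ := (q.2 y : ℝ) with hW
    have hWs : ∀ z, (((auxStep x z q).2 y : ℕ) : ℝ) = W + δ := by
      intro z
      rw [h2 z]
      simp only [Function.update_apply]
      by_cases hxy : y = x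
      · subst hxy; simp [hδ, hW]
      · simp [hxy, hδ, Ne.symm hxy, hW]
    have key : ∀ z, quad step y (auxStep x z q) =
        ((W + δ + H - (δ + e)) ^ 2 + (C - (2 * ((r : ℝ) + 1) * (δ + e) - (δ + e) ^ 2))) +
          (2 * (W + δ + H - (δ + e)) + 2 * r) * hpot step y r (x + z) := by
      intro z
      have a1 := hH (x + z, r)
      have a2 := hC (x + z, r)
      simp only [hh] at a1 a2
      push_cast at a2
      unfold quad
      rw [hWs z, h2 z]
      simp only
      rw [show ∑ j, hpot step y (Function.update q.1 i (x + z, r) j).2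
        (Function.update q.1 i (x + z, r) j).1 = H - (δ + e) + hpot step y r (x + z) by linarith]
      rw [show ∑ j, (2 * ((Function.update q.1 i (x + z, r) j).2 : ℝ) *
        hpot step y (Function.update q.1 i (x + z, r) j).2
        (Function.update q.1 i (x + z, r) j).1 - hpot step y (Function.update q.1 i (x + z, r) j).2
        (Function.update q.1 i (x + z, r) j).1 ^ 2) = C - (2 * ((r : ℝ) + 1) * (δ + e) - (δ + e) ^ 2)
          + (2 * (r : ℝ) * hpot step y r (x + z) - hpot step y r (x + z) ^ 2) by linarith]
      ring
    have hnn : ∀ z, 0 ≤ quad step y (auxStep x z q) := fun z => hp.quad_nonneg y _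
    simp only [key] at hnn ⊢
    rw [hp.tsum_lin (fun z => (hp.hpot_bd y r (x + z)).1) (fun z => (hp.hpot_bd y r (x + z)).2) hnn]
    apply ENNReal.ofReal_le_ofReal
    rw [← he]
    have hq : quad step y q = (W + H) ^ 2 + C := rfl
    rw [hq]
    have he0 : 0 ≤ e := hp.tsum_nonneg fun z => (hp.hpot_bd y r (x + z)).1
    have hr0 : (0 : ℝ) ≤ r := Nat.cast_nonneg _
    have hδ' : δ = 0 ∨ δ = 1 := by rw [hδ]; split_ifs <;> simp
    rcases hδ' with h | h <;> rw [h] <;> nlinarith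

/-- Expected early exit. -/
noncomputable def ee {d : ℕ} (step : Site d → ℝ) (V : Finset (Site d)) : ℕ → Site d → ℝ
  | 0, _ => 0
  | r + 1, x => if x ∈ V then ∑' z, step z * ee step V r (x + z) else 1

lemma Params.ee_bd {d : ℕ} {step : Site d → ℝ} {lam : ℝ} (hp : Params d step lam)
    (V : Finset (Site d)) (r : ℕ) : ∀ x, 0 ≤ ee step V r x ∧ ee step V r x ≤ 1 := by
  induction r with
  | zero => intro x; simp [ee]
  | succ r ih =>
    intro x
    have h1 := hp.tsum_nonneg fun z => (ih (x + z)).1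
    have h2 := hp.tsum_le (fun z => (ih (x + z)).1) fun z => (ih (x + z)).2
    simp only [ee]
    split_ifs
    · exact ⟨h1, h2⟩
    · norm_num

/-- Total early exit potential. -/
noncomputable def eeSum {d : ℕ} {ι : Type} [Fintype ι] (step : Site d → ℝ) (V : Finset (Site d))
    (q : Aux d ι) : ℝ := ∑ i, ee step V (q.1 i).2 (q.1 i).1

lemma Params.eeSum_nonneg {d : ℕ} {step : Site d → ℝ} {lam : ℝ} (hp : Params d step lam)
    {ι : Type} [Fintype ι] (V : Finset (Site d)) (q : Aux d ι) : 0 ≤ eeSum step V q :=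
  Finset.sum_nonneg fun i _ => (hp.ee_bd V _ _).1

lemma Params.early_le {d : ℕ} {step : Site d → ℝ} {lam : ℝ} (hp : Params d step lam)
    {ι : Type} [Fintype ι] (V : Finset (Site d)) (q : Aux d ι) :
    ((∑ i, (if (q.1 i).1 ∉ V ∧ 0 < (q.1 i).2 then 1 else 0) : ℕ) : ℝ) ≤ eeSum step V q := by
  push_cast
  refine Finset.sum_le_sum fun i _ => ?_
  split_ifs with h
  · obtain ⟨r, hr⟩ := Nat.exists_eq_succ_of_ne_zero h.2.ne'
    rw [hr]
    simp [ee, h.1]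
  · exact (hp.ee_bd V _ _).1

lemma Params.ee_super {d : ℕ} {step : Site d → ℝ} {lam : ℝ} (hp : Params d step lam)
    {ι : Type} [Fintype ι] (V : Finset (Site d)) (q : Aux d ι) (x : Site d) (hxV : x ∈ V) :
    ∑' z, ENNReal.ofReal (step z) * ENNReal.ofReal (eeSum step V (auxStep x z q)) ≤
      ENNReal.ofReal (eeSum step V q) := by
  classical
  by_cases hx : ∃ i, (q.1 i).1 = x
  swap
  · have e : ∀ z, auxStep x z q = q := fun z => by unfold auxStep; rw [dif_neg hx]
    simp only [e]
    rw [ENNReal.tsum_mul_right, hp.tsum_step, one_mul]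
  rcases auxStep_eq x 0 q with ⟨h1, _⟩ | ⟨i, hi, h2⟩
  · exact absurd hx (by simpa using h1)
  have hH := fun b => sum_update (fun p : Site d × ℕ => ee step V p.2 p.1) q.1 i b
  simp only [hi] at hH
  rcases hr : (q.1 i).2 with _ | r
  · rw [hr] at hH h2
    have e : ∀ z, eeSum step V (auxStep x z q) = eeSum step V q := by
      intro z
      have a1 := hH (x + z, 0)
      simp only [ee] at a1
      rw [h2 z]
      unfold eeSum
      simp only [Nat.zero_sub]
      exact add_right_cancel a1
    simp only [e]
    rw [ENNReal.tsum_mul_right, hp.tsum_step, one_mul]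
  · rw [hr] at hH h2
    simp only [Nat.add_sub_cancel] at h2
    have key : ∀ z, eeSum step V (auxStep x z q) =
        (eeSum step V q - ee step V (r + 1) x) + 1 * ee step V r (x + z) := by
      intro z
      have a1 := hH (x + z, r)
      rw [h2 z]
      unfold eeSum
      simp only at a1 ⊢
      linarith
    have hnn : ∀ z, 0 ≤ eeSum step V (auxStep x z q) := fun z => hp.eeSum_nonneg V _
    simp only [key] at hnn ⊢
    rw [hp.tsum_lin (fun z => (hp.ee_bd V r (x + z)).1) (fun z => (hp.ee_bd V r (x + z)).2) hnn]
    apply ENNReal.ofReal_le_ofReal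
    simp [ee, hxV]

end ARW

open MeasureTheory ENNReal Filter

namespace ARW

/-! ### The quenched inequality -/

/-- Initial labelled state. -/
noncomputable def a0 {d : ℕ} (V : Finset (Site d)) (η : Site d → ℕ) (n : ℕ) :
    Aug d (Σ x : V, Fin (η x)) :=
  (initState d V η, (fun i => ((i.1 : Site d), n), fun _ => 0))

lemma sum_a0 {d : ℕ} {M : Type*} [AddCommMonoid M] (V : Finset (Site d)) (η : Site d → ℕ)
    (f : Site d → M) : ∑ i : (Σ x : V, Fin (η x)), f i.1 = ∑ x ∈ V, η x • f x := by
  rw [Fintype.sum_sigma]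
  simp only [Finset.sum_const, Finset.card_univ, Fintype.card_fin]
  exact Finset.sum_coe_sort V (fun x => η x • f x)

lemma card_a0 {d : ℕ} (V : Finset (Site d)) (η : Site d → ℕ) :
    Fintype.card (Σ x : V, Fin (η x)) = ∑ x ∈ V, η x := by
  have := sum_a0 V η (fun _ => 1)
  simpa using this

lemma inv_a0 {d : ℕ} (V : Finset (Site d)) (η : Site d → ℕ) (n : ℕ) : Inv V n (a0 V η n) := by
  refine ⟨fun w hw => ?_, fun i => le_rfl, ?_⟩
  · have := sum_a0 V η (fun x => if x = w then 1 else 0)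
    refine this.trans ?_
    simp [a0, initState, total, hw]
  · simp [a0, mul_comm]

lemma lint_ite {d : ℕ} (μ : Measure (Stacks d)) (p : Stacks d → Prop) [DecidablePred p]
    (S : Set (Stacks d)) (h : ∀ I, p I → I ∈ S) : ∫⁻ I, (if p I then 1 else 0) ∂μ ≤ μ S := by
  calc _ ≤ ∫⁻ I, S.indicator (fun _ => 1) I ∂μ := by
        refine lintegral_mono fun I => ?_
        by_cases hI : p I
        · simp [hI, h I hI]
        · simp [hI]
    _ ≤ 1 * μ S := lintegral_indicator_const_le _ _
    _ = μ S := one_mul _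

lemma pigeon {d : ℕ} {V : Finset (Site d)} {l : List (Site d)} {K : ℕ} (hV : V.Nonempty)
    (hl : ∀ x ∈ l, x ∈ V) (h : l.length = V.card * K) : ∃ x ∈ V, K ≤ l.count x := by
  by_contra! hc
  have h1 : ∑ x ∈ V, l.count x = l.length := by
    rw [← List.sum_toFinset_count_eq_length l]
    symm
    refine Finset.sum_subset (fun x hx => hl x (by simpa using hx)) fun x _ hx => ?_
    exact List.count_eq_zero_of_not_mem (by simpa using hx)
  have h2 := Finset.sum_lt_sum_of_nonempty hV hc
  simp only [Finset.sum_const, smul_eq_mul] at h2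
  omega

lemma Params.quad_a0 {d : ℕ} {step : Site d → ℝ} {lam : ℝ} (hp : Params d step lam)
    (V : Finset (Site d)) (η : Site d → ℕ) (B n : ℕ) (hB : ∀ x, η x ≤ B) (y : Site d) :
    quad step y (a0 V η n).2 ≤ (((B ^ 2 + 2 * B) * n ^ 2 : ℕ) : ℝ) := by
  have hB0 : (0 : ℝ) ≤ B := Nat.cast_nonneg _
  have hn0 : (0 : ℝ) ≤ n := Nat.cast_nonneg _
  have h1 : ∑ i : (Σ x : V, Fin (η x)), hpot step y n i.1 ≤ (B : ℝ) * (n : ℝ) := by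
    rw [sum_a0 V η (fun x => hpot step y n x)]
    calc ∑ x ∈ V, η x • hpot step y n x ≤ ∑ x ∈ V, (B : ℝ) * hpot step y n x := by
          refine Finset.sum_le_sum fun x _ => ?_
          rw [nsmul_eq_mul]
          exact mul_le_mul_of_nonneg_right (by exact_mod_cast hB x) (hp.hpot_bd y n x).1
      _ = B * ∑ x ∈ V, hpot step y n x := by rw [Finset.mul_sum]
      _ ≤ B * n := mul_le_mul_of_nonneg_left (hp.hpot_sum y n V) hB0
  have h0 : 0 ≤ ∑ i : (Σ x : V, Fin (η x)), hpot step y n i.1 :=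
    Finset.sum_nonneg fun i _ => (hp.hpot_bd y n _).1
  have h2 : ∑ i : (Σ x : V, Fin (η x)), (2 * (n : ℝ) * hpot step y n i.1 -
      hpot step y n i.1 ^ 2) ≤ 2 * (n : ℝ) * ((B : ℝ) * (n : ℝ)) := by
    calc _ ≤ ∑ i : (Σ x : V, Fin (η x)), 2 * (n : ℝ) * hpot step y n i.1 :=
          Finset.sum_le_sum fun i _ => by nlinarith [sq_nonneg (hpot step y n i.1)]
      _ = 2 * n * ∑ i : (Σ x : V, Fin (η x)), hpot step y n i.1 := by rw [Finset.mul_sum]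
      _ ≤ _ := mul_le_mul_of_nonneg_left h1 (by positivity)
  have h3 : quad step y (a0 V η n).2 = (∑ i : (Σ x : V, Fin (η x)), hpot step y n i.1) ^ 2 +
      ∑ i : (Σ x : V, Fin (η x)), (2 * (n : ℝ) * hpot step y n i.1 -
      hpot step y n i.1 ^ 2) := by
    simp [quad, a0]
  rw [h3]
  push_cast
  nlinarith

open Classical in
set_option maxHeartbeats 1000000 in
lemma Params.quenched {d : ℕ} {step : Site d → ℝ} {lam : ℝ} (hp : Params d step lam)
    (V : Finset (Site d)) (η : Site d → ℕ) (B n K K' a : ℕ) (hB : ∀ x, η x ≤ B) :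
    ((a * n * ∑ x ∈ V, η x : ℕ) : ℝ≥0∞) ≤
      ∑ y ∈ V, (((a * K + (B ^ 2 + 2 * B) * n ^ 2 : ℕ) : ℝ≥0∞) +
        ((a ^ 2 : ℕ) : ℝ≥0∞) * stackLaw d step lam {I | OdomGe y K I η}) +
      ((a * n : ℕ) : ℝ≥0∞) * ∑ x ∈ V, stackLaw d step lam {I | StabSleep x V I η} +
      ((a * n * ∑ x ∈ V, η x : ℕ) : ℝ≥0∞) *
        ∑ x ∈ V, stackLaw d step lam {I | OdomGe x K' I η} +
      ((a * n : ℕ) : ℝ≥0∞) * ENNReal.ofReal (∑ x ∈ V, η x • ee step V n x) := by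
  have := hp.isStackLaw.1
  set μ := stackLaw d step lam with hμ
  set N := ∑ x ∈ V, η x with hN
  set T := V.card * K' with hT
  set R : Stacks d → Aug d (Σ x : V, Fin (η x)) := fun I => runA V I T (a0 V η n) with hR
  have hcard := card_a0 V η
  have hm : ∀ g : Aug d (Σ x : V, Fin (η x)) → ℝ≥0∞, Measurable (fun I => g (R I)) :=
    fun g => measurable_runA V g T (a0 V η n)
  -- pointwise inequality
  have hpt : ∀ I, ((a * n * N : ℕ) : ℝ≥0∞) ≤
      ∑ y ∈ V, (((a * K : ℕ) : ℝ≥0∞) + ENNReal.ofReal (quad step y (R I).2) +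
        ((a ^ 2 : ℕ) : ℝ≥0∞) * (if K ≤ (R I).2.2 y then 1 else 0)) +
      ((a * n : ℕ) : ℝ≥0∞) *
        ∑ x ∈ V, (if Stable V (R I).1.1 ∧ (R I).1.1 x = .sleeping then 1 else 0) +
      ((a * n * N : ℕ) : ℝ≥0∞) * (if ¬ Stable V (R I).1.1 then 1 else 0) +
      ((a * n : ℕ) : ℝ≥0∞) * ENNReal.ofReal (eeSum step V (R I).2) := by
    intro I
    have hb := (Inv.runA I T (inv_a0 V η n)).balance
    rw [hcard] at hb
    change N * n ≤ ∑ y ∈ V, (R I).2.2 y + n * ∑ x ∈ V,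
      (if Stable V (R I).1.1 ∧ (R I).1.1 x = .sleeping then 1 else 0) +
      n * (N * if Stable V (R I).1.1 then 0 else 1) +
      n * ∑ i, (if ((R I).2.1 i).1 ∉ V ∧ 0 < ((R I).2.1 i).2 then 1 else 0) at hb
    have he := hp.early_le V (R I).2
    set E := ∑ i, (if ((R I).2.1 i).1 ∉ V ∧ 0 < ((R I).2.1 i).2 then 1 else 0) with hE
    have he' : (E : ℝ≥0∞) ≤ ENNReal.ofReal (eeSum step V (R I).2) := by
      rw [← ENNReal.ofReal_natCast]; exact ENNReal.ofReal_le_ofReal he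
    have hw : ∀ y, ((a * (R I).2.2 y : ℕ) : ℝ≥0∞) ≤ ((a * K : ℕ) : ℝ≥0∞) +
        ENNReal.ofReal (quad step y (R I).2) +
        ((a ^ 2 : ℕ) : ℝ≥0∞) * (if K ≤ (R I).2.2 y then 1 else 0) := by
      intro y
      have hq := hp.sq_le_quad y (R I).2
      set w := (R I).2.2 y with hwdef
      have hq' : ((w ^ 2 : ℕ) : ℝ≥0∞) ≤ ENNReal.ofReal (quad step y (R I).2) := by
        rw [← ENNReal.ofReal_natCast]
        exact ENNReal.ofReal_le_ofReal (by push_cast; exact hq)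
      have hn : a * w ≤ a * K + w ^ 2 + a ^ 2 * (if K ≤ w then 1 else 0) := by
        split_ifs with hc
        · rcases le_total a w with h | h <;> nlinarith
        · have : a * w ≤ a * K := Nat.mul_le_mul_left a (by omega)
          omega
      calc ((a * w : ℕ) : ℝ≥0∞) ≤ ((a * K + w ^ 2 + a ^ 2 * (if K ≤ w then 1 else 0) : ℕ) : ℝ≥0∞) :=
            by exact_mod_cast hn
        _ = ((a * K : ℕ) : ℝ≥0∞) + ((w ^ 2 : ℕ) : ℝ≥0∞) +
            ((a ^ 2 : ℕ) : ℝ≥0∞) * (if K ≤ w then 1 else 0) := by push_cast; rfl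
        _ ≤ _ := by gcongr
    have hb2 : a * n * N ≤ ∑ y ∈ V, a * (R I).2.2 y + (a * n) * ∑ x ∈ V,
      (if Stable V (R I).1.1 ∧ (R I).1.1 x = .sleeping then 1 else 0) +
      (a * n * N) * (if ¬ Stable V (R I).1.1 then 1 else 0) + (a * n) * E := by
      rw [← Finset.mul_sum]
      have h1 := Nat.mul_le_mul_left a hb
      have h2 : (if ¬ Stable V (R I).1.1 then 1 else 0) = if Stable V (R I).1.1 then 0 else 1 := by
        split_ifs <;> simp_all
      rw [h2]
      calc a * n * N = a * (N * n) := by ring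
        _ ≤ _ := h1
        _ = _ := by ring
    calc ((a * n * N : ℕ) : ℝ≥0∞) ≤ _ := Nat.cast_le.mpr hb2
      _ = ∑ y ∈ V, ((a * (R I).2.2 y : ℕ) : ℝ≥0∞) + ((a * n : ℕ) : ℝ≥0∞) *
        ∑ x ∈ V, (if Stable V (R I).1.1 ∧ (R I).1.1 x = .sleeping then 1 else 0) +
      ((a * n * N : ℕ) : ℝ≥0∞) * (if ¬ Stable V (R I).1.1 then 1 else 0) +
      ((a * n : ℕ) : ℝ≥0∞) * E := by
          rw [Nat.cast_add, Nat.cast_add, Nat.cast_add, Nat.cast_mul (a * n) E, Nat.cast_sum,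
            Nat.cast_mul (a * n * N), Nat.cast_mul (a * n) (∑ x ∈ V, _), Nat.cast_sum]
          push_cast
          rfl
      _ ≤ _ := by
          gcongr with y hy
          exact hw y
  -- integrated bounds
  have hquad : ∀ y, ∫⁻ I, ENNReal.ofReal (quad step y (R I).2) ∂μ ≤
      (((B ^ 2 + 2 * B) * n ^ 2 : ℕ) : ℝ≥0∞) := by
    intro y
    refine (hp.super V (fun q => ENNReal.ofReal (quad step y q))
      (fun q x _ => hp.quad_super y q x) T (a0 V η n)).trans ?_
    rw [← ENNReal.ofReal_natCast]
    exact ENNReal.ofReal_le_ofReal (hp.quad_a0 V η B n hB y)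
  have hee : ∫⁻ I, ENNReal.ofReal (eeSum step V (R I).2) ∂μ ≤
      ENNReal.ofReal (∑ x ∈ V, η x • ee step V n x) := by
    refine (hp.super V (fun q => ENNReal.ofReal (eeSum step V q))
      (fun q x hx => hp.ee_super V q x hx) T (a0 V η n)).trans ?_
    rw [← sum_a0 V η (fun x => ee step V n x)]
    rfl
  have hod : ∀ y, ∫⁻ I, (if K ≤ (R I).2.2 y then 1 else 0) ∂μ ≤ μ {I | OdomGe y K I η} := by
    intro y
    refine lint_ite μ (fun I => K ≤ (R I).2.2 y) _ fun I hI => ?_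
    obtain ⟨l, h1, -, h3, -⟩ := runA_spec V I T (a0 V η n)
    refine ⟨V, l, h1, hI.trans ((h3 y).trans ?_)⟩
    simp [a0]
  have hsl : ∀ x, ∫⁻ I, (if Stable V (R I).1.1 ∧ (R I).1.1 x = .sleeping then 1 else 0) ∂μ ≤
      μ {I | StabSleep x V I η} := by
    intro x
    refine lint_ite μ (fun I => Stable V (R I).1.1 ∧ (R I).1.1 x = .sleeping) _ fun I hI => ?_
    obtain ⟨l, h1, h2, -⟩ := runA_spec V I T (a0 V η n)
    refine ⟨l, h1, ?_, ?_⟩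
    · have := hI.1
      rw [hR] at this
      simp only [h2] at this
      exact this
    · have := hI.2
      rw [hR] at this
      simp only [h2] at this
      exact this
  have hst : ∫⁻ I, (if ¬ Stable V (R I).1.1 then 1 else 0) ∂μ ≤
      ∑ x ∈ V, μ {I | OdomGe x K' I η} := by
    refine (lint_ite μ (fun I => ¬ Stable V (R I).1.1)
      (⋃ x ∈ V, {I | OdomGe x K' I η}) fun I hI => ?_).trans (measure_biUnion_finset_le V _)
    obtain ⟨l, h1, -, -, h4, h5⟩ := runA_spec V I T (a0 V η n)
    have hne : V.Nonempty := by
      by_contra hc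
      rw [Finset.not_nonempty_iff_eq_empty] at hc
      apply hI
      intro x hx
      rw [hc] at hx
      simp at hx
    obtain ⟨x, hx, hx2⟩ := pigeon hne h5 (h4.resolve_right hI)
    simp only [Set.mem_iUnion]
    exact ⟨x, hx, V, l, h1, hx2⟩
  -- integrate
  calc ((a * n * N : ℕ) : ℝ≥0∞) = ∫⁻ _, ((a * n * N : ℕ) : ℝ≥0∞) ∂μ := by simp
    _ ≤ _ := lintegral_mono hpt
    _ = ∑ y ∈ V, (((a * K : ℕ) : ℝ≥0∞) + ∫⁻ I, ENNReal.ofReal (quad step y (R I).2) ∂μ +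
        ((a ^ 2 : ℕ) : ℝ≥0∞) * ∫⁻ I, (if K ≤ (R I).2.2 y then 1 else 0) ∂μ) +
      ((a * n : ℕ) : ℝ≥0∞) * ∑ x ∈ V,
        ∫⁻ I, (if Stable V (R I).1.1 ∧ (R I).1.1 x = .sleeping then 1 else 0) ∂μ +
      ((a * n * N : ℕ) : ℝ≥0∞) * ∫⁻ I, (if ¬ Stable V (R I).1.1 then 1 else 0) ∂μ +
      ((a * n : ℕ) : ℝ≥0∞) * ∫⁻ I, ENNReal.ofReal (eeSum step V (R I).2) ∂μ := by
        have m1 := fun y => hm (fun b => ENNReal.ofReal (quad step y b.2))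
        have m2 := fun y => hm (fun b => if K ≤ b.2.2 y then 1 else 0)
        have m3 := fun x => hm (fun b => if Stable V b.1.1 ∧ b.1.1 x = .sleeping then 1 else 0)
        have m4 := hm (fun b => if ¬ Stable V b.1.1 then 1 else 0)
        have m5 := hm (fun b => ENNReal.ofReal (eeSum step V b.2))
        have m6 := fun y => hm (fun b => ((a * K : ℕ) : ℝ≥0∞) + ENNReal.ofReal (quad step y b.2) +
          ((a ^ 2 : ℕ) : ℝ≥0∞) * (if K ≤ b.2.2 y then 1 else 0))
        rw [lintegral_add_right _ (m5.const_mul _), lintegral_add_right _ (m4.const_mul _),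
          lintegral_add_right _ ((Finset.measurable_fun_sum V fun x _ => m3 x).const_mul _),
          lintegral_const_mul _ m5, lintegral_const_mul _ m4,
          lintegral_const_mul _ (Finset.measurable_fun_sum V fun x _ => m3 x),
          lintegral_finsetSum V fun x _ => m3 x,
          lintegral_finsetSum V fun y _ => m6 y]
        congr 3
        refine Finset.sum_congr rfl fun y _ => ?_
        rw [lintegral_add_right _ ((m2 y).const_mul _), lintegral_add_right _ (m1 y),
          lintegral_const_mul _ (m2 y)]
        simp
    _ ≤ _ := by
        gcongr with y hy x hx
        · push_cast
          gcongr
          have := hquad y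
          push_cast at this
          exact this
        · exact hod y
        · exact hsl x

end ARW

open MeasureTheory ENNReal Filter

namespace ARW

/-! ### Measurability -/

lemma measurableSet_legal {d : ℕ} (V : Finset (Site d)) (l : List (Site d)) :
    ∀ s : State d, MeasurableSet {I : Stacks d | Legal V I s l} := by
  induction l with
  | nil => intro s; simp [Legal]
  | cons x l ih =>
    intro s
    by_cases h : x ∈ V ∧ 1 ≤ numActive (s.1 x)
    · have e : {I : Stacks d | Legal V I s (x :: l)} =
          ⋃ o : Instr d, ({I | I (x, s.2 x) = o} ∩ {I | Legal V I (topInstr V o x s) l}) := by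
        ext I
        simp only [Legal, Set.mem_ofPred_eq, Set.mem_iUnion, Set.mem_inter_iff, topple_eq]
        constructor
        · intro h'; exact ⟨_, rfl, h'.2.2⟩
        · rintro ⟨o, rfl, h'⟩; exact ⟨h.1, h.2, h'⟩
      rw [e]
      refine MeasurableSet.iUnion fun o => MeasurableSet.inter ?_ (ih _)
      have hmx : Measurable (fun I : Stacks d => I (x, s.2 x)) := measurable_pi_apply _
      exact hmx (MeasurableSet.of_discrete (s := {o}))
    · have e : {I : Stacks d | Legal V I s (x :: l)} = ∅ := by
        ext I
        simp only [Legal, Set.mem_ofPred_eq, Set.mem_empty_iff_false, iff_false]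
        exact fun h' => h ⟨h'.1, h'.2.1⟩
      rw [e]; exact MeasurableSet.empty

open Classical in
lemma measurableSet_odomGe {d : ℕ} (y : Site d) (K : ℕ) :
    MeasurableSet {p : (Site d → ℕ) × Stacks d | OdomGe y K p.2 p.1} := by
  have e : {p : (Site d → ℕ) × Stacks d | OdomGe y K p.2 p.1} =
      ⋃ V : Finset (Site d), ⋃ l : List (Site d), ⋃ _ : K ≤ l.count y, ⋃ c : V → ℕ,
        ({η | ∀ x : V, η x = c x} ×ˢ
          {I | Legal V I (initState d V (fun x => if h : x ∈ V then c ⟨x, h⟩ else 0)) l}) := by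
    ext p
    simp only [OdomGe, Set.mem_ofPred_eq, Set.mem_iUnion, Set.mem_prod]
    have hinit : ∀ (V : Finset (Site d)) (η : Site d → ℕ) (c : V → ℕ), (∀ x : V, η x = c x) →
        initState d V η = initState d V (fun x => if h : x ∈ V then c ⟨x, h⟩ else 0) := by
      intro V η c h
      unfold initState
      congr 1
      funext x
      by_cases hx : x ∈ V
      · simp [hx, ← h ⟨x, hx⟩]
      · simp [hx]
    constructor
    · rintro ⟨V, l, h1, h2⟩
      refine ⟨V, l, h2, fun x => p.1 x, fun _ => rfl, ?_⟩
      rw [← hinit V p.1 (fun x => p.1 x) (fun _ => rfl)]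
      exact h1
    · rintro ⟨V, l, h2, c, h3, h4⟩
      refine ⟨V, l, ?_, h2⟩
      rw [hinit V p.1 c h3]
      exact h4
  rw [e]
  refine MeasurableSet.iUnion fun V => MeasurableSet.iUnion fun l => MeasurableSet.iUnion fun _ =>
    MeasurableSet.iUnion fun c => MeasurableSet.prod ?_ (measurableSet_legal V l _)
  rw [Set.ofPred_forall]
  refine MeasurableSet.iInter fun x => ?_
  have hmx : Measurable (fun η : Site d → ℕ => η (x : Site d)) := measurable_pi_apply _
  exact hmx (MeasurableSet.of_discrete (s := {c x}))

lemma measurable_odom {d : ℕ} (μ : Measure (Stacks d)) [SFinite μ] (y : Site d) (K : ℕ) :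
    Measurable (fun η : Site d → ℕ => μ {I | OdomGe y K I η}) :=
  measurable_measure_prodMk_left (measurableSet_odomGe y K)

lemma measurable_shift {d : ℕ} (z : Site d) : Measurable (shift z : (Site d → ℕ) → _) :=
  measurable_pi_lambda _ fun x => measurable_pi_apply (x + z)

/-- Annealed probability of a large odometer. -/
noncomputable def pK {d : ℕ} (ν : Measure (Site d → ℕ)) (μ : Measure (Stacks d)) (K : ℕ) : ℝ≥0∞ :=
  ∫⁻ η, μ {I | OdomGe 0 K I η} ∂ν

lemma Params.pK_shift {d : ℕ} {step : Site d → ℝ} {lam : ℝ} (hp : Params d step lam)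
    {ν : Measure (Site d → ℕ)} (hinv : ∀ z, Measure.map (shift z) ν = ν) (y : Site d) (K : ℕ) :
    ∫⁻ η, stackLaw d step lam {I | OdomGe y K I η} ∂ν ≤ pK ν (stackLaw d step lam) K := by
  have := hp.isStackLaw.1
  unfold pK
  conv_rhs => rw [← hinv y]
  rw [lintegral_map (measurable_odom _ 0 K) (measurable_shift y)]
  refine lintegral_mono fun η => ?_
  refine le_trans (measure_mono fun I hI => ?_)
    (hp.tau_le y {I | OdomGe 0 K I (shift y η)})
  exact tau_odomGe _ hI

lemma Params.pK_tendsto {d : ℕ} {step : Site d → ℝ} {lam : ℝ} (hp : Params d step lam)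
    {ν : Measure (Site d → ℕ)} [IsProbabilityMeasure ν] (hf : Fixates d step lam ν) :
    Tendsto (pK ν (stackLaw d step lam)) atTop (nhds 0) := by
  have := hp.isStackLaw.1
  set μ := stackLaw d step lam with hμ
  have e : ∀ K, pK ν μ K = (ν.prod μ) {p | OdomGe 0 K p.2 p.1} := by
    intro K
    rw [Measure.prod_apply (measurableSet_odomGe 0 K)]
    rfl
  have h1 : Tendsto (fun K => (ν.prod μ) {p : (Site d → ℕ) × Stacks d | OdomGe 0 K p.2 p.1}) atTop
      (nhds ((ν.prod μ) (⋂ K, {p | OdomGe 0 K p.2 p.1}))) := by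
    refine tendsto_measure_iInter_atTop (fun K => (measurableSet_odomGe 0 K).nullMeasurableSet)
      ?_ ⟨0, measure_ne_top _ _⟩
    intro K K' h p hp
    obtain ⟨V, l, h1, h2⟩ := hp
    exact ⟨V, l, h1, h.trans h2⟩
  have h2 : (ν.prod μ) (⋂ K, {p | OdomGe 0 K p.2 p.1}) = 0 := by
    rw [Measure.measure_prod_null (MeasurableSet.iInter fun K => measurableSet_odomGe 0 K)]
    filter_upwards [hf] with η hη
    refine measure_mono_null ?_ hη
    intro I hI
    simp only [Set.mem_preimage, Set.mem_iInter, Set.mem_ofPred_eq] at hI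
    simp only [Set.mem_compl_iff, Set.mem_ofPred_eq, not_not]
    exact odom0_eq_top hI
  rw [h2] at h1
  exact h1.congr fun K => (e K).symm

lemma pK_le_one {d : ℕ} (ν : Measure (Site d → ℕ)) [IsProbabilityMeasure ν] (μ : Measure (Stacks d))
    [IsProbabilityMeasure μ] (K : ℕ) : pK ν μ K ≤ 1 := by
  calc pK ν μ K ≤ ∫⁻ _, 1 ∂ν := lintegral_mono fun η => prob_le_one
    _ = 1 := by simp

set_option maxHeartbeats 1000000 in
lemma Params.annealed {d : ℕ} {step : Site d → ℝ} {lam : ℝ} (hp : Params d step lam)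
    {ν : Measure (Site d → ℕ)} [IsProbabilityMeasure ν]
    (hinv : ∀ z, Measure.map (shift z) ν = ν) {B : ℕ} (hB : ∀ᵐ η ∂ν, ∀ x, η x ≤ B) {r q : ℝ≥0∞}
    (hmean : ∫⁻ η, (η 0 : ℝ≥0∞) ∂ν = r) {V0 : Finset (Site d)}
    (hq : ∀ U, V0 ⊆ U → ∀ ξ, stackLaw d step lam {I | SleepAt0 U I ξ} ≤ q)
    (V Vo : Finset (Site d)) (hVo : Vo ⊆ V) (n K K' a : ℕ) (δ : ℝ)
    (h1 : ∀ x ∈ Vo, V0 ⊆ tauV x V) (h2 : ∀ x ∈ Vo, ee step V n x ≤ n * δ) :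
    ((a * n : ℕ) : ℝ≥0∞) * (V.card * r) ≤
      V.card * (((a * K + (B ^ 2 + 2 * B) * n ^ 2 : ℕ) : ℝ≥0∞) +
        ((a ^ 2 : ℕ) : ℝ≥0∞) * pK ν (stackLaw d step lam) K) +
      ((a * n : ℕ) : ℝ≥0∞) * (Vo.card * q + (V \ Vo).card) +
      ((a * n * (V.card * B) : ℕ) : ℝ≥0∞) * (V.card * pK ν (stackLaw d step lam) K') +
      ((a * n : ℕ) : ℝ≥0∞) * ENNReal.ofReal (B * (Vo.card * (n * δ) + (V \ Vo).card)) := by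
  have := hp.isStackLaw.1
  set μ := stackLaw d step lam with hμ
  have hm : ∀ x, ∫⁻ η : Site d → ℕ, (η x : ℝ≥0∞) ∂ν = r := by
    intro x
    have hm0 : Measurable (fun η : Site d → ℕ => (η 0 : ℝ≥0∞)) :=
      (measurable_from_top (f := fun k : ℕ => (k : ℝ≥0∞))).comp (measurable_pi_apply 0)
    rw [← hmean]
    conv_rhs => rw [← hinv x]
    rw [lintegral_map hm0 (measurable_shift x)]
    simp [shift]
  have hstab : ∀ η, ∑ x ∈ V, μ {I | StabSleep x V I η} ≤ Vo.card * q + (V \ Vo).card := by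
    intro η
    rw [← Finset.sum_sdiff hVo, add_comm]
    refine add_le_add ?_ ?_
    · refine (Finset.sum_le_card_nsmul _ _ q fun x hx => ?_).trans (by simp)
      refine le_trans (measure_mono fun I hI => ?_)
        ((hp.tau_le x {I | SleepAt0 (tauV x V) I (shift x η)}).trans (hq _ (h1 x hx) _))
      exact (tau_stabSleep _ hI).sleepAt0
    · exact (Finset.sum_le_card_nsmul _ _ 1 fun x hx => prob_le_one).trans (by simp)
  have hee : ∀ η : Site d → ℕ, (∀ x, η x ≤ B) → ∑ x ∈ V, η x • ee step V n x ≤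
      B * (Vo.card * (n * δ) + (V \ Vo).card) := by
    intro η hη
    calc ∑ x ∈ V, η x • ee step V n x ≤ ∑ x ∈ V, (B : ℝ) * ee step V n x := by
          refine Finset.sum_le_sum fun x _ => ?_
          rw [nsmul_eq_mul]
          exact mul_le_mul_of_nonneg_right (by exact_mod_cast hη x) (hp.ee_bd V n x).1
      _ = B * ∑ x ∈ V, ee step V n x := by rw [Finset.mul_sum]
      _ ≤ _ := by
          refine mul_le_mul_of_nonneg_left ?_ (Nat.cast_nonneg _)
          rw [← Finset.sum_sdiff hVo, add_comm]
          refine add_le_add ?_ ?_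
          · exact (Finset.sum_le_card_nsmul _ _ _ fun x hx => h2 x hx).trans (by simp)
          · exact (Finset.sum_le_card_nsmul _ _ 1 fun x hx => (hp.ee_bd V n x).2).trans (by simp)
  have hNm : Measurable (fun η : Site d → ℕ => ∑ x ∈ V, (η x : ℝ≥0∞)) :=
    Finset.measurable_fun_sum V fun x _ =>
      (measurable_from_top (f := fun k : ℕ => (k : ℝ≥0∞))).comp (measurable_pi_apply x)
  have hpt : ∀ᵐ η ∂ν, ((a * n : ℕ) : ℝ≥0∞) * ∑ x ∈ V, (η x : ℝ≥0∞) ≤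
      ∑ y ∈ V, (((a * K + (B ^ 2 + 2 * B) * n ^ 2 : ℕ) : ℝ≥0∞) +
        ((a ^ 2 : ℕ) : ℝ≥0∞) * μ {I | OdomGe y K I η}) +
      ((a * n : ℕ) : ℝ≥0∞) * (Vo.card * q + (V \ Vo).card) +
      ((a * n * (V.card * B) : ℕ) : ℝ≥0∞) * ∑ x ∈ V, μ {I | OdomGe x K' I η} +
      ((a * n : ℕ) : ℝ≥0∞) * ENNReal.ofReal (B * (Vo.card * (n * δ) + (V \ Vo).card)) := by
    filter_upwards [hB] with η hη
    have hN : ∑ x ∈ V, η x ≤ V.card * B :=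
      (Finset.sum_le_card_nsmul _ _ B fun x _ => hη x).trans (by simp)
    have e : ((a * n : ℕ) : ℝ≥0∞) * ∑ x ∈ V, (η x : ℝ≥0∞) =
      ((a * n * ∑ x ∈ V, η x : ℕ) : ℝ≥0∞) := by push_cast; rfl
    rw [e]
    refine (hp.quenched V η B n K K' a hη).trans ?_
    gcongr
    · exact hstab η
    · exact hee η hη
  have mo := fun y K => measurable_odom μ y K
  calc ((a * n : ℕ) : ℝ≥0∞) * (V.card * r)
      = ∫⁻ η, ((a * n : ℕ) : ℝ≥0∞) * ∑ x ∈ V, (η x : ℝ≥0∞) ∂ν := by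
        rw [lintegral_const_mul _ hNm, lintegral_finsetSum]
        · simp [hm]
        · exact fun x _ =>
            (measurable_from_top (f := fun k : ℕ => (k : ℝ≥0∞))).comp (measurable_pi_apply x)
    _ ≤ _ := lintegral_mono_ae hpt
    _ = ∑ y ∈ V, (((a * K + (B ^ 2 + 2 * B) * n ^ 2 : ℕ) : ℝ≥0∞) +
        ((a ^ 2 : ℕ) : ℝ≥0∞) * ∫⁻ η, μ {I | OdomGe y K I η} ∂ν) +
      ((a * n : ℕ) : ℝ≥0∞) * (Vo.card * q + (V \ Vo).card) +
      ((a * n * (V.card * B) : ℕ) : ℝ≥0∞) * ∑ x ∈ V, ∫⁻ η, μ {I | OdomGe x K' I η} ∂ν +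
      ((a * n : ℕ) : ℝ≥0∞) * ENNReal.ofReal (B * (Vo.card * (n * δ) + (V \ Vo).card)) := by
        have m1 : Measurable (fun η => ∑ x ∈ V, μ {I | OdomGe x K' I η}) :=
          Finset.measurable_fun_sum V fun x _ => mo x K'
        have m2 : ∀ y, Measurable (fun η => ((a * K + (B ^ 2 + 2 * B) * n ^ 2 : ℕ) : ℝ≥0∞) +
          ((a ^ 2 : ℕ) : ℝ≥0∞) * μ {I | OdomGe y K I η}) :=
            fun y => ((mo y K).const_mul _).const_add _
        rw [lintegral_add_right _ measurable_const, lintegral_add_right _ (m1.const_mul _),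
          lintegral_add_right _ measurable_const, lintegral_const_mul _ m1,
          lintegral_finsetSum V fun x _ => mo x K', lintegral_finsetSum V fun y _ => m2 y]
        simp only [lintegral_const, measure_univ, mul_one]
        congr 3
        refine Finset.sum_congr rfl fun y _ => ?_
        rw [lintegral_add_left measurable_const, lintegral_const_mul _ (mo y K)]
        simp
    _ ≤ _ := by
        gcongr
        · refine (Finset.sum_le_card_nsmul _ _ _ fun y hy => ?_).trans (le_of_eq (nsmul_eq_mul _ _))
          gcongr
          exact hp.pK_shift hinv y K
        · refine (Finset.sum_le_card_nsmul _ _ _ fun y hy => ?_).trans (le_of_eq (nsmul_eq_mul _ _))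
          exact hp.pK_shift hinv y K'

end ARW

open MeasureTheory ENNReal Filter

namespace ARW

/-! ### Boxes -/

/-- The centred box of radius `k`. -/
noncomputable def box (d : ℕ) (k : ℤ) : Finset (Site d) := Finset.Icc (fun _ => -k) (fun _ => k)

lemma mem_box {d : ℕ} {k : ℤ} {x : Site d} : x ∈ box d k ↔ ∀ i, -k ≤ x i ∧ x i ≤ k := by
  simp only [box, Finset.mem_Icc, Pi.le_def]
  exact ⟨fun h i => ⟨h.1 i, h.2 i⟩, fun h => ⟨fun i => (h i).1, fun i => (h i).2⟩⟩

lemma box_mono {d : ℕ} {k l : ℤ} (h : k ≤ l) : box d k ⊆ box d l := by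
  intro x hx
  rw [mem_box] at *
  intro i
  have := hx i
  constructor <;> linarith

lemma add_mem_box {d : ℕ} {k l : ℤ} {x y : Site d} (hx : x ∈ box d k) (hy : y ∈ box d l) :
    x + y ∈ box d (k + l) := by
  rw [mem_box] at *
  intro i
  have := hx i
  have := hy i
  simp only [Pi.add_apply]
  constructor <;> linarith

lemma card_box {d : ℕ} (k : ℕ) : (box d k).card = (2 * k + 1) ^ d := by
  simp only [box, Pi.card_Icc, Int.card_Icc, Finset.prod_const, Finset.card_univ, Fintype.card_fin]
  congr 1
  omega

lemma exists_box {d : ℕ} (F : Finset (Site d)) : ∃ M : ℕ, F ⊆ box d M := by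
  refine ⟨∑ x ∈ F, ∑ i, (x i).natAbs, fun x hx => ?_⟩
  rw [mem_box]
  intro i
  have h1 : (x i).natAbs ≤ ∑ i, (x i).natAbs :=
    Finset.single_le_sum (f := fun i => (x i).natAbs) (fun _ _ => Nat.zero_le _) (Finset.mem_univ i)
  have h2 : ∑ i, (x i).natAbs ≤ ∑ x ∈ F, ∑ i, (x i).natAbs :=
    Finset.single_le_sum (f := fun x : Site d => ∑ i, (x i).natAbs) (fun _ _ => Nat.zero_le _) hx
  omega

lemma Params.ee_le {d : ℕ} {step : Site d → ℝ} {lam : ℝ} (hp : Params d step lam) {δ : ℝ} {R : ℕ}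
    (hR : 1 - δ ≤ ∑ z ∈ box d R, step z) (L : ℤ) (r : ℕ) :
    ∀ x, x ∈ box d (L - r * R) → ee step (box d L) r x ≤ r * δ := by
  induction r with
  | zero => intro x _; simp [ee]
  | succ r ih =>
    intro x hx
    have hr0 : (0 : ℤ) ≤ r := Int.natCast_nonneg _
    have hR0 : (0 : ℤ) ≤ R := Int.natCast_nonneg _
    push_cast at hx
    have hxV : x ∈ box d L := box_mono (by nlinarith) hx
    have hδ0 : 0 ≤ δ := by
      have := hp.sum.summable.sum_le_tsum (box d R) (fun z _ => hp.nonneg z)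
      rw [hp.sum.tsum_eq] at this
      linarith
    simp only [ee, hxV, if_true]
    set V := box d L with hV
    have hs := hp.smul_summable (fun z => (hp.ee_bd V r (x + z)).1) fun z => (hp.ee_bd V r (x + z)).2
    have hs1 : Summable (fun z => step z * (r * δ)) := hp.sum.summable.mul_right _
    have hs2 : Summable (fun z => (box d R : Set (Site d))ᶜ.indicator step z) :=
      hp.sum.summable.indicator _
    have h3 : ∑' z, (box d R : Set (Site d))ᶜ.indicator step z ≤ δ := by
      have h4 := hp.sum.summable.sum_add_tsum_compl (s := box d R)
      rw [hp.sum.tsum_eq, tsum_subtype] at h4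
      linarith
    calc ∑' z, step z * ee step V r (x + z)
        ≤ ∑' z, (step z * (r * δ) + (box d R : Set (Site d))ᶜ.indicator step z) := by
          refine hs.tsum_le_tsum (fun z => ?_) (hs1.add hs2)
          by_cases hz : z ∈ box d R
          · have h5 : x + z ∈ box d (L - r * R) := by
              have := add_mem_box hx hz
              convert this using 2
              ring
            rw [Set.indicator_of_notMem (by simpa using hz), add_zero]
            exact mul_le_mul_of_nonneg_left (ih _ h5) (hp.nonneg z)
          · rw [Set.indicator_of_mem (by simpa using hz)]
            have h6 := mul_le_mul_of_nonneg_left (hp.ee_bd V r (x + z)).2 (hp.nonneg z)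
            have h7 : 0 ≤ step z * (r * δ) := mul_nonneg (hp.nonneg z) (by positivity)
            linarith
      _ = r * δ + ∑' z, (box d R : Set (Site d))ᶜ.indicator step z := by
          rw [hs1.tsum_add hs2, tsum_mul_right, hp.sum.tsum_eq, one_mul]
      _ ≤ _ := by push_cast; linarith

lemma Params.exists_R {d : ℕ} {step : Site d → ℝ} {lam : ℝ} (hp : Params d step lam) {δ : ℝ}
    (hδ : 0 < δ) : ∃ R : ℕ, 1 - δ ≤ ∑ z ∈ box d R, step z := by
  have h := hp.sum.eventually (lt_mem_nhds (show 1 - δ < 1 by linarith))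
  obtain ⟨F, hF⟩ := h.exists
  obtain ⟨R, hR⟩ := exists_box F
  exact ⟨R, hF.le.trans (Finset.sum_le_sum_of_subset_of_nonneg hR fun z _ _ => hp.nonneg z)⟩

lemma sdiff_box {d : ℕ} (L M : ℕ) (h : M ≤ L) :
    (((box d L) \ (box d (L - M : ℤ))).card : ℝ) ≤
      (box d L).card * (2 * d * M / (2 * L + 1)) := by
  have hsub : box d (L - M : ℤ) ⊆ box d L := box_mono (by omega)
  rw [Finset.card_sdiff_of_subset hsub, Nat.cast_sub (Finset.card_le_card hsub)]
  have e : ((L : ℤ) - M) = ((L - M : ℕ) : ℤ) := by omega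
  rw [e, card_box, card_box]
  push_cast [Nat.cast_sub h]
  have hL : (0 : ℝ) < 2 * L + 1 := by positivity
  have hML : (M : ℝ) ≤ L := by exact_mod_cast h
  have hb := one_add_mul_le_pow (a := -(2 * M / (2 * L + 1) : ℝ)) (by
    have : (2 * M / (2 * L + 1) : ℝ) ≤ 1 := by rw [div_le_one hL]; linarith
    linarith) d
  have e2 : (2 * ((L : ℝ) - M) + 1) ^ d = (2 * L + 1) ^ d * (1 + -(2 * M / (2 * L + 1))) ^ d := by
    rw [← mul_pow]
    congr 1
    field_simp
    ring
  rw [e2]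
  have h3 : (0 : ℝ) ≤ (2 * L + 1) ^ d := by positivity
  have h4 := mul_le_mul_of_nonneg_left hb h3
  have e3 : (2 * d * M / (2 * L + 1) : ℝ) = d * (2 * M / (2 * L + 1)) := by ring
  rw [e3]
  linarith

lemma Params.annealed_real {d : ℕ} {step : Site d → ℝ} {lam : ℝ} (hp : Params d step lam)
    {ν : Measure (Site d → ℕ)} [IsProbabilityMeasure ν]
    (hinv : ∀ z, Measure.map (shift z) ν = ν) {B : ℕ} (hB : ∀ᵐ η ∂ν, ∀ x, η x ≤ B) {r q : ℝ≥0∞}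
    (hr : r ≠ ⊤) (hqt : q ≠ ⊤)
    (hmean : ∫⁻ η, (η 0 : ℝ≥0∞) ∂ν = r) {V0 : Finset (Site d)}
    (hq : ∀ U, V0 ⊆ U → ∀ ξ, stackLaw d step lam {I | SleepAt0 U I ξ} ≤ q)
    (V Vo : Finset (Site d)) (hVo : Vo ⊆ V) (n K K' a : ℕ) (δ : ℝ) (hδ : 0 ≤ δ)
    (h1 : ∀ x ∈ Vo, V0 ⊆ tauV x V) (h2 : ∀ x ∈ Vo, ee step V n x ≤ n * δ) :
    (a * n : ℝ) * (V.card * r.toReal) ≤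
      V.card * ((a * K + (B ^ 2 + 2 * B) * n ^ 2) +
        a ^ 2 * (pK ν (stackLaw d step lam) K).toReal) +
      (a * n) * (Vo.card * q.toReal + (V \ Vo).card) +
      (a * n * (V.card * B)) * (V.card * (pK ν (stackLaw d step lam) K').toReal) +
      (a * n) * (B * (Vo.card * (n * δ) + (V \ Vo).card)) := by
  have h := hp.annealed hinv hB hmean hq V Vo hVo n K K' a δ h1 h2
  have := hp.isStackLaw.1
  have hp1 : pK ν (stackLaw d step lam) K ≠ ⊤ := ((pK_le_one ν _ K).trans_lt one_lt_top).ne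
  have hp2 : pK ν (stackLaw d step lam) K' ≠ ⊤ := ((pK_le_one ν _ K').trans_lt one_lt_top).ne
  generalize pK ν (stackLaw d step lam) K = p at *
  generalize pK ν (stackLaw d step lam) K' = p' at *
  clear hmean hq
  lift r to NNReal using hr
  lift q to NNReal using hqt
  lift p to NNReal using hp1
  lift p' to NNReal using hp2
  unfold ENNReal.ofReal at h
  have h' := h
  norm_cast at h'
  have h'' := NNReal.coe_le_coe.mpr h'
  push_cast at h''
  rw [Real.coe_toNNReal _ (by positivity)] at h''
  simpa using h''

end ARW

open MeasureTheory ENNReal Filter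

namespace ARW

lemma Params.density_le {d : ℕ} {step : Site d → ℝ} {lam : ℝ} (hp : Params d step lam)
    {ν : Measure (Site d → ℕ)} [IsProbabilityMeasure ν]
    (hinv : ∀ z, Measure.map (shift z) ν = ν) {B : ℕ} (hB : ∀ᵐ η ∂ν, ∀ x, η x ≤ B) {r q : ℝ≥0∞}
    (hr : r ≠ ⊤) (hqt : q ≠ ⊤)
    (hmean : ∫⁻ η, (η 0 : ℝ≥0∞) ∂ν = r) {V0 : Finset (Site d)}
    (hq : ∀ U, V0 ⊆ U → ∀ ξ, stackLaw d step lam {I | SleepAt0 U I ξ} ≤ q)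
    (hf : Fixates d step lam ν) : r.toReal ≤ q.toReal := by
  have := hp.isStackLaw.1
  refine le_of_forall_pos_le_add fun ε' hε' => ?_
  obtain ⟨ε, hε, hεε⟩ : ∃ ε : ℝ, 0 < ε ∧ ε' = 6 * ε := ⟨ε' / 6, by positivity, by ring⟩
  have hpt : Tendsto (fun K => (pK ν (stackLaw d step lam) K).toReal) atTop (nhds 0) := by
    have := (ENNReal.tendsto_toReal (a := 0) (by simp)).comp (hp.pK_tendsto hf)
    simpa [Function.comp_def] using this
  have hp0 : ∀ K, 0 ≤ (pK ν (stackLaw d step lam) K).toReal := fun K => ENNReal.toReal_nonneg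
  set p : ℕ → ℝ := fun K => (pK ν (stackLaw d step lam) K).toReal with hpdef
  -- generic choice of a small odometer tail
  have hsmall : ∀ C : ℝ, 0 ≤ C → ∃ K : ℕ, 1 ≤ K ∧ C * p K ≤ ε := by
    intro C hC
    have h1 : Tendsto (fun K => C * p K) atTop (nhds 0) := by simpa using hpt.const_mul C
    obtain ⟨K, hK1, hK2⟩ := ((h1.eventually (gt_mem_nhds hε)).and (eventually_ge_atTop 1)).exists
    exact ⟨K, hK2, hK1.le⟩
  -- generic choice of a large natural number
  have hlarge : ∀ C : ℝ, ∃ m : ℕ, 1 ≤ m ∧ C ≤ m * ε := by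
    intro C
    obtain ⟨m, hm⟩ := exists_nat_ge (C / ε)
    refine ⟨m + 1, by omega, ?_⟩
    rw [div_le_iff₀ hε] at hm
    push_cast
    nlinarith
  obtain ⟨m, hm1, hm⟩ := hlarge 1
  obtain ⟨A, hA1, hA⟩ := hlarge ((B : ℝ) ^ 2 + 2 * B)
  obtain ⟨K, hK1, hK⟩ := hsmall A (Nat.cast_nonneg _)
  set n : ℕ := m * K with hn
  have hn1 : 1 ≤ n := Nat.mul_pos hm1 hK1
  obtain ⟨δ, hδ, hδ2⟩ : ∃ δ : ℝ, 0 < δ ∧ B * (n * δ) ≤ ε := by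
    refine ⟨ε / (B * n + 1), by positivity, ?_⟩
    rw [← mul_assoc, mul_div_assoc', div_le_iff₀ (by positivity)]
    nlinarith
  obtain ⟨R, hR⟩ := hp.exists_R hδ
  obtain ⟨M0, hM0⟩ := exists_box V0
  set M : ℕ := max M0 (n * R) with hM
  obtain ⟨L0, hL01, hL0⟩ := hlarge ((1 + B) * (2 * d * M))
  set L : ℕ := L0 + M with hL
  set V := box d (L : ℤ) with hV
  set Vo := box d ((L : ℤ) - M) with hVo
  have hVoV : Vo ⊆ V := box_mono (by omega)
  have hVpos : (0 : ℝ) < V.card := by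
    rw [hV, card_box]; positivity
  obtain ⟨K', -, hK'⟩ := hsmall (B * V.card) (by positivity)
  have h1 : ∀ x ∈ Vo, V0 ⊆ tauV x V := by
    intro x hx v hv
    rw [mem_tauV]
    have h3 : v ∈ box d (M : ℤ) := box_mono (by rw [hM]; push_cast; exact le_max_left _ _) (hM0 hv)
    have := add_mem_box h3 hx
    exact box_mono (by omega) this
  have h2 : ∀ x ∈ Vo, ee step V n x ≤ n * δ := by
    intro x hx
    refine hp.ee_le hR L n x (box_mono ?_ hx)
    have : (n * R : ℕ) ≤ M := le_max_right _ _
    have : ((n : ℤ) * R) ≤ M := by exact_mod_cast this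
    omega
  have hmain := hp.annealed_real hinv hB hr hqt hmean hq V Vo hVoV n K K' (A * n) δ hδ.le h1 h2
  change _ ≤ (V.card : ℝ) * (_ + _ * p K) + _ + _ * (_ * p K') + _ at hmain
  have hsd : ((V \ Vo).card : ℝ) ≤ V.card * (2 * d * M / (2 * L + 1)) := sdiff_box L M (by omega)
  have hratio : (1 + (B : ℝ)) * (2 * d * M / (2 * L + 1)) ≤ ε := by
    rw [mul_div_assoc', div_le_iff₀ (by positivity)]
    refine hL0.trans ?_
    have : (L0 : ℝ) ≤ 2 * L + 1 := by
      rw [hL]; push_cast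
      have h1 : (0 : ℝ) ≤ M := Nat.cast_nonneg _
      have h2 : (0 : ℝ) ≤ L0 := Nat.cast_nonneg _
      linarith
    nlinarith
  have hcard : (Vo.card : ℝ) ≤ V.card := by exact_mod_cast Finset.card_le_card hVoV
  have hnpos : (0 : ℝ) < n := by exact_mod_cast hn1
  have hApos : (0 : ℝ) < A := by exact_mod_cast hA1
  have hKn : (K : ℝ) ≤ n * ε := by
    have h3 : (0 : ℝ) ≤ K := Nat.cast_nonneg _
    have h4 : (n : ℝ) = m * K := by rw [hn]; push_cast; ring
    rw [h4]
    nlinarith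
  push_cast at hmain
  set v : ℝ := (V.card : ℝ) with hv
  set w : ℝ := ((V \ Vo).card : ℝ) with hw
  set ρ := r.toReal
  set s := q.toReal
  have hs0 : 0 ≤ s := ENNReal.toReal_nonneg
  have hB0 : (0 : ℝ) ≤ B := Nat.cast_nonneg _
  have hw' : (1 + (B : ℝ)) * w ≤ v * ε := by
    calc (1 + (B : ℝ)) * w ≤ (1 + B) * (v * (2 * d * M / (2 * L + 1))) :=
          mul_le_mul_of_nonneg_left hsd (by positivity)
      _ = v * ((1 + B) * (2 * d * M / (2 * L + 1))) := by ring
      _ ≤ v * ε := mul_le_mul_of_nonneg_left hratio hVpos.le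
  -- bound each term by a multiple of `A n² v`
  have hX : (0 : ℝ) < A * n * n * v := by positivity
  have t1 : v * (A * n * K) ≤ A * n * n * v * ε := by
    have := mul_le_mul_of_nonneg_left hKn (show 0 ≤ v * (A * n) by positivity)
    calc v * (A * n * K) = v * (A * n) * K := by ring
      _ ≤ _ := this
      _ = _ := by ring
  have t2 : v * (((B : ℝ) ^ 2 + 2 * B) * n ^ 2) ≤ A * n * n * v * ε := by
    have := mul_le_mul_of_nonneg_left hA (show 0 ≤ v * n ^ 2 by positivity)
    calc v * (((B : ℝ) ^ 2 + 2 * B) * n ^ 2) = v * n ^ 2 * ((B : ℝ) ^ 2 + 2 * B) := by ring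
      _ ≤ _ := this
      _ = _ := by ring
  have t3 : v * ((A * n) ^ 2 * p K) ≤ A * n * n * v * ε := by
    have := mul_le_mul_of_nonneg_left hK hX.le
    calc v * ((A * n) ^ 2 * p K) = A * n * n * v * (A * p K) := by ring
      _ ≤ _ := this
  have t4 : A * n * n * (Vo.card * s) ≤ A * n * n * v * s := by
    have := mul_le_mul_of_nonneg_left (mul_le_mul_of_nonneg_right hcard hs0)
      (show 0 ≤ (A : ℝ) * n * n by positivity)
    linarith
  have t5 : (A : ℝ) * n * n * (v * B) * (v * p K') ≤ A * n * n * v * ε := by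
    have := mul_le_mul_of_nonneg_left hK' hX.le
    calc (A : ℝ) * n * n * (v * B) * (v * p K') = A * n * n * v * (B * v * p K') := by ring
      _ ≤ _ := this
  have t6 : (A : ℝ) * n * n * (B * (Vo.card * (n * δ))) ≤ A * n * n * v * ε := by
    have h3 : (B : ℝ) * (Vo.card * (n * δ)) ≤ v * ε := by
      calc (B : ℝ) * (Vo.card * (n * δ)) = Vo.card * (B * (n * δ)) := by ring
        _ ≤ v * ε := mul_le_mul hcard hδ2 (by positivity) hVpos.le
    have := mul_le_mul_of_nonneg_left h3 (show 0 ≤ (A : ℝ) * n * n by positivity)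
    linarith
  have t7 : (A : ℝ) * n * n * ((1 + B) * w) ≤ A * n * n * v * ε := by
    have := mul_le_mul_of_nonneg_left hw' (show 0 ≤ (A : ℝ) * n * n by positivity)
    linarith
  have hfin : (A : ℝ) * n * n * v * ρ ≤ A * n * n * v * (s + ε') := by
    rw [hεε]
    linarith
  exact le_of_mul_le_mul_left hfin hX

end ARW

open MeasureTheory ENNReal Filter

namespace ARW

/-! ### An ergodic distribution of any given density -/

/-- The rotation number. -/
noncomputable def rotA : UnitAddCircle := ((Real.sqrt 2 : ℝ) : UnitAddCircle)

lemma ergodic_rotA : Ergodic (rotA + · : UnitAddCircle → UnitAddCircle) volume := by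
  rw [ergodic_add_left_iff_denseRange_zsmul]
  unfold rotA
  rw [AddCircle.denseRange_zsmul_coe_iff]
  simpa using irrational_sqrt_two

open Classical in
/-- The configuration driven by a rotation. -/
noncomputable def rotConf {k : ℕ} (b : ℕ) (f : ℝ) (θ : UnitAddCircle) : Site (k + 1) → ℕ :=
  fun x => b + if θ + (x 0) • rotA ∈ Metric.closedBall (0 : UnitAddCircle) (f / 2) then 1 else 0

lemma shift_rotConf {k : ℕ} (b : ℕ) (f : ℝ) (θ : UnitAddCircle) (z : Site (k + 1)) :
    shift z (rotConf b f θ) = rotConf b f ((z 0) • rotA + θ) := by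
  funext x
  unfold shift rotConf
  have : θ + (x + z) 0 • rotA = z 0 • rotA + θ + x 0 • rotA := by
    rw [Pi.add_apply, add_smul]; abel
  rw [this]

lemma measurable_rotConf {k : ℕ} (b : ℕ) (f : ℝ) :
    Measurable (rotConf b f : UnitAddCircle → Site (k + 1) → ℕ) := by
  classical
  refine measurable_pi_lambda _ fun x => ?_
  unfold rotConf
  refine Measurable.const_add (Measurable.ite ?_ measurable_const measurable_const) _
  have hm : Measurable (fun θ : UnitAddCircle => θ + (x 0) • rotA) := measurable_add_const _
  exact hm Metric.isClosed_closedBall.measurableSet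

lemma exists_law (k : ℕ) (ρ : ℝ) (hρ : 0 ≤ ρ) : ∃ ν : Measure (Site (k + 1) → ℕ),
    IsProbabilityMeasure ν ∧ IsTransErgodic ν ∧ (∫⁻ η, (η 0 : ℝ≥0∞) ∂ν) = ENNReal.ofReal ρ ∧
      ∃ B : ℕ, ∀ᵐ η ∂ν, ∀ x, η x ≤ B := by
  classical
  have hprob : IsProbabilityMeasure (volume : Measure UnitAddCircle) :=
    ⟨UnitAddCircle.measure_univ⟩
  set b := ⌊ρ⌋₊ with hb
  set f := ρ - b with hf
  have hf0 : 0 ≤ f := by rw [hf, hb]; linarith [Nat.floor_le hρ]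
  have hf1 : f ≤ 1 := by rw [hf, hb]; linarith [Nat.lt_floor_add_one ρ]
  have hm := measurable_rotConf (k := k) b f
  refine ⟨Measure.map (rotConf b f) volume, Measure.isProbabilityMeasure_map hm.aemeasurable,
    ⟨fun z => ?_, fun s hs hinv => ?_⟩, ?_, b + 1, ?_⟩
  · rw [Measure.map_map (measurable_shift z) hm]
    have e : shift z ∘ (rotConf b f : UnitAddCircle → Site (k + 1) → ℕ) =
        rotConf b f ∘ ((z 0) • rotA + ·) := by
      funext θ
      exact shift_rotConf b f θ z
    rw [e, ← Measure.map_map hm (measurable_const_add _),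
      (measurePreserving_add_left volume ((z 0) • rotA)).map_eq]
  · rw [Measure.map_apply hm hs]
    refine ergodic_rotA.toPreErgodic.prob_eq_zero_or_one (hm hs) ?_
    ext θ
    simp only [Set.mem_preimage]
    have h1 := shift_rotConf (k := k) b f θ (Pi.single 0 1)
    simp only [Pi.single_eq_same, one_smul] at h1
    rw [← h1]
    have h2 := hinv (Pi.single 0 1)
    exact Iff.of_eq (congrArg (fun S : Set (Site (k + 1) → ℕ) => rotConf b f θ ∈ S) h2)
  · have hm0 : Measurable (fun η : Site (k + 1) → ℕ => (η 0 : ℝ≥0∞)) :=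
      (measurable_from_top (f := fun k : ℕ => (k : ℝ≥0∞))).comp (measurable_pi_apply 0)
    rw [lintegral_map hm0 hm]
    have e : ∀ θ : UnitAddCircle, ((rotConf b f θ (0 : Site (k + 1)) : ℕ) : ℝ≥0∞) =
        (b : ℝ≥0∞) + (Metric.closedBall (0 : UnitAddCircle) (f / 2)).indicator 1 θ := by
      intro θ
      simp only [rotConf, Pi.zero_apply, zero_smul, add_zero, Set.indicator_apply, Pi.one_apply]
      split_ifs <;> simp
    simp only [e]
    rw [lintegral_add_left measurable_const,
      lintegral_indicator_one Metric.isClosed_closedBall.measurableSet,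
      AddCircle.volume_closedBall]
    simp only [lintegral_const, measure_univ, mul_one]
    rw [show (2 : ℝ) * (f / 2) = f by ring, min_eq_right hf1, ← ENNReal.ofReal_natCast,
      ← ENNReal.ofReal_add (Nat.cast_nonneg _) hf0]
    congr 1
    rw [hf]; ring
  · rw [ae_map_iff hm.aemeasurable]
    · refine Eventually.of_forall fun θ x => ?_
      unfold rotConf
      split_ifs <;> omega
    · rw [Set.ofPred_forall]
      refine MeasurableSet.iInter fun x => ?_
      have hmx : Measurable (fun η : Site (k + 1) → ℕ => η x) := measurable_pi_apply _
      exact hmx (MeasurableSet.of_discrete (s := Set.Iic (b + 1)))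

/-- In dimension zero the critical density is the junk value zero. -/
lemma critDensity_zero (step : Site 0 → ℝ) (lam : ℝ) : critDensity 0 step lam = 0 := by
  unfold critDensity
  apply Real.sSup_of_not_bddAbove
  rintro ⟨C, hC⟩
  obtain ⟨m, hm⟩ := exists_nat_gt C
  have : ((m : ℝ) + 1 / 2) ∈ {ρ : ℝ | 0 ≤ ρ ∧
    ∀ ν : Measure (Site 0 → ℕ), IsProbabilityMeasure ν → IsTransErgodic ν →
      (∫⁻ η, (η 0 : ℝ≥0∞) ∂ν) = ENNReal.ofReal ρ → Fixates 0 step lam ν} := by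
    refine ⟨by positivity, fun ν hν herg hmean => ?_⟩
    exfalso
    have hm0 : Measurable (fun η : Site 0 → ℕ => (η 0 : ℝ≥0∞)) :=
      (measurable_from_top (f := fun k : ℕ => (k : ℝ≥0∞))).comp (measurable_pi_apply 0)
    have hmx : Measurable (fun η : Site 0 → ℕ => η 0) := measurable_pi_apply _
    have hs : MeasurableSet {η : Site 0 → ℕ | η 0 ≤ m} :=
      hmx (MeasurableSet.of_discrete (s := Set.Iic m))
    have hid : ∀ z : Site 0, shift z = (id : (Site 0 → ℕ) → _) := by
      intro z
      funext η x
      simp only [shift, id]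
      congr 1
      exact Subsingleton.elim _ _
    rcases herg.2 _ hs (fun z => by rw [hid]; rfl) with h | h
    · -- almost surely at least `m + 1` particles
      have h1 : ∀ᵐ η ∂ν, ((m + 1 : ℕ) : ℝ≥0∞) ≤ (η 0 : ℝ≥0∞) := by
        have : ∀ᵐ η ∂ν, ¬ (η 0 ≤ m) := by
          rw [ae_iff]; simpa using h
        filter_upwards [this] with η hη
        exact_mod_cast Nat.lt_of_not_le hη
      have h2 := lintegral_mono_ae h1
      rw [hmean] at h2
      simp only [lintegral_const, measure_univ, mul_one] at h2
      rw [← ENNReal.ofReal_natCast, ENNReal.ofReal_le_ofReal_iff (by positivity)] at h2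
      push_cast at h2
      linarith
    · have h1 : ∀ᵐ η ∂ν, (η 0 : ℝ≥0∞) ≤ (m : ℝ≥0∞) := by
        have : ∀ᵐ η ∂ν, η 0 ≤ m := by
          rw [← prob_compl_eq_zero_iff hs] at h
          exact h
        filter_upwards [this] with η hη
        exact_mod_cast hη
      have h2 := lintegral_mono_ae h1
      rw [hmean] at h2
      simp only [lintegral_const, measure_univ, mul_one] at h2
      rw [← ENNReal.ofReal_natCast, ENNReal.ofReal_le_ofReal_iff (by positivity)] at h2
      linarith
  have := hC this
  linarith

end ARW

open MeasureTheory ENNReal Filter Topology ARW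

theorem arw_critDensity_le_limsup_stab_prob (d : ℕ) (step : Site d → ℝ) (h0 : ∀ z, 0 ≤ step z) (h1 : HasSum step 1)
    (lam : ℝ) (hlam : 0 < lam) :
    ENNReal.ofReal (critDensity d step lam) ≤
      ⨅ V : Finset (Site d), ⨆ U : Finset (Site d), ⨆ _ : V ⊆ U, ⨆ ξ : Site d → ℕ,
        stackLaw d step lam {I | SleepAt0 U I ξ} := by
  have hp : Params d step lam := ⟨h0, h1, hlam⟩
  have hprob := hp.isStackLaw.1
  rcases d with _ | k
  · rw [critDensity_zero]; simp
  refine le_iInf fun V0 => ?_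
  set q : ℝ≥0∞ := ⨆ U : Finset (Site (k + 1)), ⨆ _ : V0 ⊆ U, ⨆ ξ : Site (k + 1) → ℕ,
        stackLaw (k + 1) step lam {I | SleepAt0 U I ξ} with hqdef
  have hq1 : q ≤ 1 := iSup_le fun U => iSup_le fun _ => iSup_le fun ξ => prob_le_one
  have hqt : q ≠ ⊤ := (hq1.trans_lt one_lt_top).ne
  have hq : ∀ U, V0 ⊆ U → ∀ ξ, stackLaw (k + 1) step lam {I | SleepAt0 U I ξ} ≤ q :=
    fun U hU ξ => le_iSup_of_le U (le_iSup_of_le hU (le_iSup_of_le ξ le_rfl))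
  rw [ENNReal.ofReal_le_iff_le_toReal hqt]
  refine Real.sSup_le ?_ ENNReal.toReal_nonneg
  rintro ρ ⟨hρ, hfix⟩
  obtain ⟨ν, hν, herg, hmean, B, hB⟩ := exists_law k ρ hρ
  have := hp.density_le herg.1 hB ENNReal.ofReal_ne_top hqt hmean hq (hfix ν hν herg hmean)
  rwa [ENNReal.toReal_ofReal hρ] at this
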